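/- Let p(y,z1,z2|x) be a discrete memoryless two-level security wiretap channel satisfying the Markov chain X → Z1 → Z2. If a nonnegative pair (R1,R2) satisfies R1 ≤ I(V;Y|U) − I(V;Z1|U) and R1 + R2 ≤ I(V;Y) − I(V;Z2) for some joint distribution p(u,v,x), where U and V are auxiliary random variables (over finite alphabets) satisfying the Markov chain U → V → X → (Y,Z1,Z2) and such that I(U;Y) ≥ I(U;Z2), then (R1,R2) is an achievable rate pair of the channel. -/

import Mathlib

open scoped BigOperators
noncomputable section

/-- A probability mass function on a finite type. -/
def IsPMF {α : Type*} [Fintype α] (p : α → ℝ) : Prop :=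
  (∀ a, 0 ≤ p a) ∧ ∑ a, p a = 1

/-- A discrete channel from `α` to `β`: every input determines a pmf on outputs. -/
def IsChannel {α β : Type*} [Fintype β] (W : α → β → ℝ) : Prop :=
  ∀ a, IsPMF (W a)

/-- Mutual information (in bits) of a joint pmf on `α × β`. -/
def mutInfo {α β : Type*} [Fintype α] [Fintype β] (p : α × β → ℝ) : ℝ :=
  ∑ ab : α × β,
    p ab * Real.logb 2 (p ab / ((∑ b, p (ab.1, b)) * (∑ a, p (a, ab.2))))

variable {𝒳 𝒴 𝒵₁ 𝒵₂ : Type} [Fintype 𝒳] [Fintype 𝒴] [Fintype 𝒵₁] [Fintype 𝒵₂]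

/-- The Markov chain `X → Z₁ → Z₂` for the channel `W : 𝒳 → 𝒴 × 𝒵₁ × 𝒵₂`:
the eavesdropper output `Z₂` is degraded with respect to `Z₁`. -/
def DegradedZ1Z2 (W : 𝒳 → 𝒴 × 𝒵₁ × 𝒵₂ → ℝ) : Prop :=
  ∃ q : 𝒵₁ → 𝒵₂ → ℝ, IsChannel q ∧
    ∀ x z₁ z₂, (∑ y, W x (y, z₁, z₂)) = (∑ y, ∑ z₂', W x (y, z₁, z₂')) * q z₁ z₂

/-- Joint pmf of messages, inputs and outputs induced by a (possibly stochastic) encoder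
`enc` used on the memoryless channel `W` with uniform independent messages. -/
def codeJoint {n K₁ K₂ : ℕ} (W : 𝒳 → 𝒴 × 𝒵₁ × 𝒵₂ → ℝ)
    (enc : Fin K₁ × Fin K₂ → (Fin n → 𝒳) → ℝ)
    (m : Fin K₁ × Fin K₂) (xs : Fin n → 𝒳) (ys : Fin n → 𝒴)
    (z1s : Fin n → 𝒵₁) (z2s : Fin n → 𝒵₂) : ℝ :=
  ((K₁ : ℝ) * (K₂ : ℝ))⁻¹ * enc m xs * ∏ i, W (xs i) (ys i, z1s i, z2s i)

/-- Average probability of a decoding error at the legitimate receiver. -/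
def errProb {n K₁ K₂ : ℕ} (W : 𝒳 → 𝒴 × 𝒵₁ × 𝒵₂ → ℝ)
    (enc : Fin K₁ × Fin K₂ → (Fin n → 𝒳) → ℝ)
    (dec : (Fin n → 𝒴) → Fin K₁ × Fin K₂) : ℝ :=
  ∑ m, ∑ xs, ∑ ys, ∑ z1s, ∑ z2s,
    if dec ys ≠ m then codeJoint W enc m xs ys z1s z2s else 0

/-- The information leakage `I(M₁,M₂; Z₂ⁿ)` to the weak eavesdropper realization. -/
def leakMZ2 {n K₁ K₂ : ℕ} (W : 𝒳 → 𝒴 × 𝒵₁ × 𝒵₂ → ℝ)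
    (enc : Fin K₁ × Fin K₂ → (Fin n → 𝒳) → ℝ) : ℝ :=
  mutInfo (fun q : (Fin K₁ × Fin K₂) × (Fin n → 𝒵₂) =>
    ∑ xs, ∑ ys, ∑ z1s, codeJoint W enc q.1 xs ys z1s q.2)

/-- The information leakage `I(M₁; Z₁ⁿ)` to the strong eavesdropper realization. -/
def leakM1Z1 {n K₁ K₂ : ℕ} (W : 𝒳 → 𝒴 × 𝒵₁ × 𝒵₂ → ℝ)
    (enc : Fin K₁ × Fin K₂ → (Fin n → 𝒳) → ℝ) : ℝ :=
  mutInfo (fun q : Fin K₁ × (Fin n → 𝒵₁) =>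
    ∑ m₂, ∑ xs, ∑ ys, ∑ z2s, codeJoint W enc (q.1, m₂) xs ys q.2 z2s)

/-- A rate pair `(R₁,R₂)` is achievable for the two-level security wiretap channel `W`:
there are codes of blocklength `n` whose rates are arbitrarily close to `(R₁,R₂)`, with
vanishing error probability at the legitimate receiver, vanishing normalized leakage
`(1/n) I(M₁,M₂;Z₂ⁿ)` of both messages to the weak eavesdropper realization, and vanishing
normalized leakage `(1/n) I(M₁;Z₁ⁿ)` of the high-security message to the strong one. -/
def Achievable (W : 𝒳 → 𝒴 × 𝒵₁ × 𝒵₂ → ℝ) (R₁ R₂ : ℝ) : Prop :=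
  ∀ ε > 0, ∃ n : ℕ, 0 < n ∧ ∃ K₁ K₂ : ℕ, 0 < K₁ ∧ 0 < K₂ ∧
    (n : ℝ) * (R₁ - ε) ≤ Real.logb 2 K₁ ∧ (n : ℝ) * (R₂ - ε) ≤ Real.logb 2 K₂ ∧
    ∃ enc : Fin K₁ × Fin K₂ → (Fin n → 𝒳) → ℝ, IsChannel enc ∧
      ∃ dec : (Fin n → 𝒴) → Fin K₁ × Fin K₂,
        errProb W enc dec ≤ ε ∧
        leakMZ2 W enc ≤ (n : ℝ) * ε ∧
        leakM1Z1 W enc ≤ (n : ℝ) * ε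

/-- Conditional mutual information `I(A;B|C)` (in bits) of a joint pmf on `α × β × γ`,
where the conditioning variable is the third coordinate. -/
def condMutInfo {α β γ : Type*} [Fintype α] [Fintype β] [Fintype γ]
    (p : α × β × γ → ℝ) : ℝ :=
  ∑ x : α × β × γ,
    p x * Real.logb 2
      (((∑ a, ∑ b, p (a, b, x.2.2)) * p x) /
        ((∑ b, p (x.1, b, x.2.2)) * (∑ a, p (a, x.2.1, x.2.2))))

/-- Marginal channel to the legitimate receiver. -/
def WY (W : 𝒳 → 𝒴 × 𝒵₁ × 𝒵₂ → ℝ) (x : 𝒳) (y : 𝒴) : ℝ := ∑ z₁, ∑ z₂, W x (y, z₁, z₂)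

/-- Marginal channel to the strong eavesdropper realization. -/
def WZ1 (W : 𝒳 → 𝒴 × 𝒵₁ × 𝒵₂ → ℝ) (x : 𝒳) (z₁ : 𝒵₁) : ℝ := ∑ y, ∑ z₂, W x (y, z₁, z₂)

/-- Marginal channel to the weak eavesdropper realization. -/
def WZ2 (W : 𝒳 → 𝒴 × 𝒵₁ × 𝒵₂ → ℝ) (x : 𝒳) (z₂ : 𝒵₂) : ℝ := ∑ y, ∑ z₁, W x (y, z₁, z₂)

lemma tw_sum_pi {I G : Type*} [Fintype I] [DecidableEq I] [Fintype G] (f : I → G → ℝ) :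
    ∑ c : I → G, ∏ i, f i (c i) = ∏ i, ∑ g, f i g := by
  rw [Finset.prod_univ_sum]
  rfl

lemma tw_marg1 {I G : Type*} [Fintype I] [DecidableEq I] [Fintype G] (w : G → ℝ)
    (hw : ∑ g, w g = 1) (i : I) (f : G → ℝ) :
    ∑ c : I → G, (∏ j, w (c j)) * f (c i) = ∑ g, w g * f g := by
  have h := tw_sum_pi (fun (j : I) (g : G) => w g * (if j = i then f g else 1))
  have h2 : ∀ c : I → G, ∏ j, w (c j) * (if j = i then f (c j) else 1)
      = (∏ j, w (c j)) * f (c i) := by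
    intro c
    rw [Finset.prod_mul_distrib]
    simp
  simp only [h2] at h
  rw [h, ← Finset.mul_prod_erase _ _ (Finset.mem_univ i)]
  simp only [if_true]
  rw [Finset.prod_eq_one, mul_one]
  intro j hj
  have : j ≠ i := (Finset.mem_erase.mp hj).1
  simp [this, hw]

lemma tw_marg2 {I G : Type*} [Fintype I] [DecidableEq I] [Fintype G] (w : G → ℝ)
    (hw : ∑ g, w g = 1) (i k : I) (hik : i ≠ k) (f h : G → ℝ) :
    ∑ c : I → G, (∏ j, w (c j)) * (f (c i) * h (c k))
      = (∑ g, w g * f g) * (∑ g, w g * h g) := by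
  have H := tw_sum_pi (fun (j : I) (g : G) => w g * (if j = i then f g else 1)
    * (if j = k then h g else 1))
  have h2 : ∀ c : I → G, ∏ j, w (c j) * (if j = i then f (c j) else 1)
      * (if j = k then h (c j) else 1)
      = (∏ j, w (c j)) * (f (c i) * h (c k)) := by
    intro c
    rw [Finset.prod_mul_distrib, Finset.prod_mul_distrib]
    simp [mul_assoc]
  simp only [h2] at H
  rw [H, ← Finset.mul_prod_erase _ _ (Finset.mem_univ i),
    ← Finset.mul_prod_erase _ _ (Finset.mem_erase.mpr ⟨hik.symm, Finset.mem_univ k⟩)]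
  rw [Finset.prod_eq_one, mul_one]
  · simp [hik, hik.symm]
  intro j hj
  have h3 : j ≠ k := (Finset.mem_erase.mp hj).1
  have h4 : j ≠ i := (Finset.mem_erase.mp (Finset.mem_erase.mp hj).2).1
  simp [h3, h4, hw]

/-- tangent line bound for the binary logarithm -/
lemma tw_lg_tangent {x y : ℝ} (hx : 0 < x) (hy : 0 < y) :
    Real.logb 2 x ≤ Real.logb 2 y + (x / y - 1) / Real.log 2 := by
  have h2 : 0 < Real.log 2 := Real.log_pos (by norm_num)
  have h := Real.log_le_sub_one_of_pos (div_pos hx hy)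
  rw [Real.log_div hx.ne' hy.ne'] at h
  unfold Real.logb
  rw [← add_div]
  gcongr
  linarith

lemma tw_jensen {I G T : Type*} [Fintype I] [DecidableEq I] [Fintype G] [Fintype T] [Nonempty T]
    (w : G → ℝ) (hw0 : ∀ g, 0 ≤ w g) (hw : ∑ g, w g = 1) (F : G → ℝ) (hF : ∀ g, 0 ≤ F g)
    (j : T → I) (hj : Function.Injective j) (α β : ℝ) (hα : 0 ≤ α) (hβ : 0 ≤ β) :
    ∑ c : I → G, (∏ i, w (c i)) *
      (((Fintype.card T : ℝ)⁻¹ * ∑ t, F (c (j t))) *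
        Real.logb 2 (α + β * ((Fintype.card T : ℝ)⁻¹ * ∑ t, F (c (j t)))))
    ≤ ∑ g, w g * (F g * Real.logb 2 (α + β * ((Fintype.card T : ℝ)⁻¹ * F g + ∑ g, w g * F g))) := by
  classical
  set N : ℝ := (Fintype.card T : ℝ) with hN
  have hNpos : 0 < N := by rw [hN]; exact_mod_cast Fintype.card_pos
  set E : ℝ := ∑ g, w g * F g with hE
  have hE0 : 0 ≤ E := Finset.sum_nonneg fun g _ => mul_nonneg (hw0 g) (hF g)
  set y : G → ℝ := fun g => α + β * (N⁻¹ * F g + E) with hy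
  have hy0 : ∀ g, 0 ≤ y g := fun g => by
    have := hF g
    simp only [hy]; positivity
  have hl2 : 0 < Real.log 2 := Real.log_pos (by norm_num)
  have hpw : ∀ c : I → G, 0 ≤ ∏ i, w (c i) := fun c => Finset.prod_nonneg fun i _ => hw0 _
  set X : (I → G) → ℝ := fun c => N⁻¹ * ∑ t, F (c (j t)) with hX
  -- bound for each t
  have key : ∀ t : T, ∑ c : I → G, (∏ i, w (c i)) * (F (c (j t)) * Real.logb 2 (α + β * X c))
      ≤ ∑ g, w g * (F g * Real.logb 2 (y g)) := by
    intro t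
    have hpt : ∀ c : I → G, (F (c (j t)) * Real.logb 2 (α + β * X c)) ≤
        F (c (j t)) * Real.logb 2 (y (c (j t))) +
          (F (c (j t)) / y (c (j t)) * (α + β * X c) - F (c (j t))) / Real.log 2
          + (if y (c (j t)) = 0 then F (c (j t)) / Real.log 2 else 0) := by
      intro c
      have hXle : N⁻¹ * F (c (j t)) ≤ X c := by
        simp only [hX]
        gcongr
        exact Finset.single_le_sum (f := fun t => F (c (j t))) (fun t _ => hF _) (Finset.mem_univ t)
      rcases (hF (c (j t))).eq_or_lt with h0 | h0
      · rw [← h0]; simp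
      · have hXpos : 0 < X c := lt_of_lt_of_le (by positivity) hXle
        by_cases hyz : y (c (j t)) = 0
        · have h1 : β * (N⁻¹ * F (c (j t)) + E) = 0 := by
            have : 0 ≤ β * (N⁻¹ * F (c (j t)) + E) := by positivity
            simp only [hy] at hyz; linarith
          have h2 : β = 0 := by
            rcases mul_eq_zero.mp h1 with h | h
            · exact h
            · have : 0 < N⁻¹ * F (c (j t)) + E := by positivity
              linarith
          have h3 : α = 0 := by
            simp only [hy] at hyz; linarith
          simp [hyz, h2, h3]
          rw [neg_div]; simp
        · have hypos := lt_of_le_of_ne (hy0 (c (j t))) (Ne.symm hyz)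
          have hxpos : 0 < α + β * X c := by
            rcases hα.eq_or_lt with h | h
            · rcases hβ.eq_or_lt with h' | h'
              · exfalso; apply hyz; simp [hy, ← h, ← h']
              · positivity
            · positivity
          have := mul_le_mul_of_nonneg_left (tw_lg_tangent hxpos hypos) h0.le
          rw [if_neg hyz, add_zero]
          refine this.trans (le_of_eq ?_)
          ring
    -- expectation of linear term
    have hlin : ∑ c : I → G, (∏ i, w (c i)) *
        ((F (c (j t)) / y (c (j t)) * (α + β * X c) - F (c (j t))) / Real.log 2
          + (if y (c (j t)) = 0 then F (c (j t)) / Real.log 2 else 0)) ≤ 0 := by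
      have hXs : ∀ c : I → G, F (c (j t)) / y (c (j t)) * (α + β * X c) =
          F (c (j t)) / y (c (j t)) * (α + β * (N⁻¹ * F (c (j t)))) +
          ∑ t' ∈ Finset.univ.erase t, β * N⁻¹ * (F (c (j t)) / y (c (j t)) * F (c (j t'))) := by
        intro c
        simp only [hX]
        rw [← Finset.add_sum_erase _ _ (Finset.mem_univ t), ← Finset.mul_sum, ← Finset.mul_sum]
        ring
      have e1 : ∑ c : I → G, (∏ i, w (c i)) * (F (c (j t)) / y (c (j t)) * (α + β * X c)) ≤
          ∑ g, w g * (F g / y g * y g) := by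
        simp only [hXs, mul_add, Finset.sum_add_distrib, Finset.mul_sum]
        rw [Finset.sum_comm (s := Finset.univ) (t := Finset.univ.erase t)]
        have e2 : ∀ t' ∈ Finset.univ.erase t, ∑ c : I → G, (∏ i, w (c i)) *
            (β * N⁻¹ * (F (c (j t)) / y (c (j t)) * F (c (j t'))))
            = β * N⁻¹ * ((∑ g, w g * (F g / y g)) * E) := by
          intro t' ht'
          have hne : j t ≠ j t' := fun h => (Finset.mem_erase.mp ht').1 (hj h).symm
          rw [← tw_marg2 w hw (j t) (j t') hne (fun g => F g / y g) F, Finset.mul_sum]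
          refine Finset.sum_congr rfl fun c _ => by ring
        rw [Finset.sum_congr rfl e2, Finset.sum_const, Finset.card_erase_of_mem (Finset.mem_univ t)]
        have m1 := tw_marg1 (I := I) w hw (j t) (fun g => F g / y g * (α + β * (N⁻¹ * F g)))
        simp only [mul_add, Finset.sum_add_distrib] at m1
        rw [m1, nsmul_eq_mul]
        have hS : 0 ≤ ∑ g, w g * (F g / y g) := Finset.sum_nonneg fun g _ =>
          mul_nonneg (hw0 g) (div_nonneg (hF g) (hy0 g))
        have hc : (((Finset.univ : Finset T).card - 1 : ℕ) : ℝ) * (β * N⁻¹ * ((∑ g, w g * (F g / y g)) * E))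
            ≤ β * ((∑ g, w g * (F g / y g)) * E) := by
          have : (((Finset.univ : Finset T).card - 1 : ℕ) : ℝ) ≤ N := by
            rw [hN, Finset.card_univ]; exact_mod_cast Nat.sub_le _ _
          calc _ ≤ N * (β * N⁻¹ * ((∑ g, w g * (F g / y g)) * E)) := by gcongr
            _ = _ := by field_simp
        refine (add_le_add_right hc _).trans (le_of_eq ?_)
        rw [Finset.sum_mul, Finset.mul_sum, ← Finset.sum_add_distrib, ← Finset.sum_add_distrib]
        refine Finset.sum_congr rfl fun g _ => ?_
        simp only [hy]; ring
      have e3 : ∑ c : I → G, (∏ i, w (c i)) *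
        ((F (c (j t)) / y (c (j t)) * (α + β * X c) - F (c (j t))) / Real.log 2
          + (if y (c (j t)) = 0 then F (c (j t)) / Real.log 2 else 0)) =
          (∑ c : I → G, (∏ i, w (c i)) * (F (c (j t)) / y (c (j t)) * (α + β * X c))) / Real.log 2
          + ∑ c : I → G, (∏ i, w (c i)) * (- F (c (j t)) / Real.log 2 +
            (if y (c (j t)) = 0 then F (c (j t)) / Real.log 2 else 0)) := by
        rw [Finset.sum_div, ← Finset.sum_add_distrib]
        refine Finset.sum_congr rfl fun c _ => by ring
      rw [e3, tw_marg1 w hw (j t) (fun g => - F g / Real.log 2 +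
            (if y g = 0 then F g / Real.log 2 else 0))]
      have e4 : (∑ c : I → G, (∏ i, w (c i)) * (F (c (j t)) / y (c (j t)) * (α + β * X c))) / Real.log 2
        ≤ (∑ g, w g * (F g / y g * y g)) / Real.log 2 := by gcongr
      refine (add_le_add_left e4 _).trans (le_of_eq ?_)
      rw [Finset.sum_div, ← Finset.sum_add_distrib]
      refine Finset.sum_eq_zero fun g _ => ?_
      by_cases h : y g = 0
      · simp [h]; right; ring
      · rw [if_neg h]; field_simp; ring
    calc _ ≤ ∑ c : I → G, ((∏ i, w (c i)) * (F (c (j t)) * Real.logb 2 (y (c (j t)))) +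
        (∏ i, w (c i)) *
        ((F (c (j t)) / y (c (j t)) * (α + β * X c) - F (c (j t))) / Real.log 2
          + (if y (c (j t)) = 0 then F (c (j t)) / Real.log 2 else 0))) := by
          refine Finset.sum_le_sum fun c _ => ?_
          rw [← mul_add, ← add_assoc]
          exact mul_le_mul_of_nonneg_left (hpt c) (hpw c)
      _ ≤ _ := by
          rw [Finset.sum_add_distrib,
            tw_marg1 w hw (j t) (fun g => F g * Real.logb 2 (y g))]
          linarith
  have hfin : ∑ c : I → G, (∏ i, w (c i)) * (X c * Real.logb 2 (α + β * X c))
      = N⁻¹ * ∑ t, ∑ c : I → G, (∏ i, w (c i)) * (F (c (j t)) * Real.logb 2 (α + β * X c)) := by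
    rw [Finset.sum_comm, Finset.mul_sum]
    refine Finset.sum_congr rfl fun c _ => ?_
    rw [← Finset.mul_sum, ← Finset.sum_mul]
    have : X c = N⁻¹ * ∑ t, F (c (j t)) := rfl
    rw [this]
    ring
  refine hfin.le.trans ?_
  calc _ ≤ N⁻¹ * ∑ t : T, ∑ g, w g * (F g * Real.logb 2 (y g)) := by
        gcongr with t; exact key t
    _ = _ := by
        rw [Finset.sum_const, nsmul_eq_mul, Finset.card_univ, ← hN,
          inv_mul_cancel_left₀ hNpos.ne']

/-- log-sum inequality -/
lemma tw_logsum {ι : Type*} [Fintype ι] (a b : ι → ℝ) (ha : ∀ i, 0 ≤ a i) (hb : ∀ i, 0 ≤ b i)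
    (hab : ∀ i, 0 < a i → 0 < b i) :
    (∑ i, a i) * Real.logb 2 ((∑ i, a i) / ∑ i, b i) ≤ ∑ i, a i * Real.logb 2 (a i / b i) := by
  have hl2 : 0 < Real.log 2 := Real.log_pos (by norm_num)
  set A := ∑ i, a i with hA
  set B := ∑ i, b i with hB
  rcases (Finset.sum_nonneg fun i (_ : i ∈ Finset.univ) => ha i : 0 ≤ ∑ i, a i).eq_or_lt with h0 | h0
  · have : ∀ i, a i = 0 := fun i =>
      (Finset.sum_eq_zero_iff_of_nonneg (fun i _ => ha i)).mp h0.symm i (Finset.mem_univ i)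
    rw [hA, ← h0]; simp [this]
  · have hBpos : 0 < B := by
      obtain ⟨i, _, hi⟩ := Finset.exists_lt_of_sum_lt (f := fun _ => (0:ℝ)) (g := a) (s := Finset.univ) (by simpa using h0)
      exact lt_of_lt_of_le (hab i hi) (Finset.single_le_sum (f := b) (fun i _ => hb i) (Finset.mem_univ i))
    rw [← hA] at h0
    have hpt : ∀ i, a i * Real.logb 2 (A / B) ≤ a i * Real.logb 2 (a i / b i) +
        (b i * (A / B) - a i) / Real.log 2 := by
      intro i
      rcases (ha i).eq_or_lt with h | h
      · rw [← h]; simp; have := hb i; positivity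
      · have hbi := hab i h
        have := mul_le_mul_of_nonneg_left
          (tw_lg_tangent (x := A / B) (y := a i / b i) (by positivity) (by positivity)) h.le
        refine this.trans (le_of_eq ?_)
        field_simp
    calc A * Real.logb 2 (A / B) = ∑ i, a i * Real.logb 2 (A / B) := by rw [← Finset.sum_mul]
      _ ≤ ∑ i, (a i * Real.logb 2 (a i / b i) + (b i * (A / B) - a i) / Real.log 2) :=
        Finset.sum_le_sum fun i _ => hpt i
      _ = ∑ i, a i * Real.logb 2 (a i / b i) := by
        rw [Finset.sum_add_distrib, ← Finset.sum_div, Finset.sum_sub_distrib, ← Finset.sum_mul,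
          ← hA, ← hB]
        field_simp
        simp

/-- nonnegativity of divergence -/
lemma tw_kl_nonneg {ι : Type*} [Fintype ι] (a b : ι → ℝ) (ha : ∀ i, 0 ≤ a i) (hb : ∀ i, 0 ≤ b i)
    (hab : ∀ i, 0 < a i → 0 < b i) (h1 : ∑ i, a i = 1) (h2 : ∑ i, b i = 1) :
    0 ≤ ∑ i, a i * Real.logb 2 (a i / b i) := by
  have := tw_logsum a b ha hb hab
  simpa [h1, h2] using this

/-- mutual information is at most average divergence to any reference pmf -/
lemma tw_mi_le {M Z : Type*} [Fintype M] [Nonempty M] [Fintype Z] (P : M → Z → ℝ) (Q : Z → ℝ)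
    (hP : IsChannel P) (hQ : IsPMF Q) (hPQ : ∀ m z, 0 < P m z → 0 < Q z) (κ : ℝ)
    (hκ : κ = (Fintype.card M : ℝ)⁻¹) :
    mutInfo (fun q : M × Z => κ * P q.1 q.2) ≤
      κ * ∑ m, ∑ z, P m z * Real.logb 2 (P m z / Q z) := by
  have hκ0 : 0 < κ := by rw [hκ]; have : 0 < Fintype.card M := Fintype.card_pos; positivity
  set R : Z → ℝ := fun z => ∑ m, κ * P m z with hR
  have hR0 : ∀ z, 0 ≤ R z := fun z => Finset.sum_nonneg fun m _ => mul_nonneg hκ0.le ((hP m).1 z)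
  have hR1 : ∑ z, R z = 1 := by
    simp only [hR]
    rw [Finset.sum_comm]
    simp only [← Finset.mul_sum, (hP _).2]
    simp [hκ]
  have hPR : ∀ m z, 0 < P m z → 0 < R z := fun m z h =>
    lt_of_lt_of_le (mul_pos hκ0 h) (Finset.single_le_sum (f := fun m => κ * P m z)
      (fun m _ => mul_nonneg hκ0.le ((hP m).1 z)) (Finset.mem_univ m))
  have hRQ : ∀ z, 0 < R z → 0 < Q z := by
    intro z h
    obtain ⟨m, _, hm⟩ := Finset.exists_lt_of_sum_lt (f := fun _ => (0:ℝ))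
      (g := fun m => κ * P m z) (s := Finset.univ) (by simpa using h)
    exact hPQ m z (pos_of_mul_pos_right hm hκ0.le)
  have hkl := tw_kl_nonneg R Q hR0 hQ.1 hRQ hR1 hQ.2
  have e1 : mutInfo (fun q : M × Z => κ * P q.1 q.2) =
      ∑ m, ∑ z, κ * P m z * Real.logb 2 (P m z / R z) := by
    unfold mutInfo
    rw [Fintype.sum_prod_type]
    refine Finset.sum_congr rfl fun m _ => Finset.sum_congr rfl fun z _ => ?_
    simp only [← Finset.mul_sum (f := fun z => P m z), (hP m).2]
    congr 2
    have : ∑ a, κ * P a z = R z := rfl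
    rw [this, mul_one, mul_div_mul_left _ _ hκ0.ne']
  have e2 : κ * ∑ m, ∑ z, P m z * Real.logb 2 (P m z / Q z) =
      (∑ m, ∑ z, κ * P m z * Real.logb 2 (P m z / R z)) + ∑ z, R z * Real.logb 2 (R z / Q z) := by
    have : ∑ z, R z * Real.logb 2 (R z / Q z) = ∑ m, ∑ z, κ * P m z * Real.logb 2 (R z / Q z) := by
      rw [Finset.sum_comm]
      refine Finset.sum_congr rfl fun z _ => ?_
      rw [← Finset.sum_mul]
    rw [this, ← Finset.sum_add_distrib, Finset.mul_sum]
    refine Finset.sum_congr rfl fun m _ => ?_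
    rw [← Finset.sum_add_distrib, Finset.mul_sum]
    refine Finset.sum_congr rfl fun z _ => ?_
    rcases ((hP m).1 z).eq_or_lt with h | h
    · simp [← h]
    · have h1 := hPR m z h
      have h2 := hPQ m z h
      rw [Real.logb_div h.ne' h2.ne', Real.logb_div h.ne' h1.ne', Real.logb_div h1.ne' h2.ne']
      ring
  rw [e1, e2]
  linarith

def twQU {U V Z : Type*} [Fintype V] (K : U → V → ℝ) (Q : V → Z → ℝ) (u : U) (z : Z) : ℝ :=
  ∑ v, K u v * Q v z

def twQP {U V Z : Type*} [Fintype U] [Fintype V] (PU : U → ℝ) (K : U → V → ℝ) (Q : V → Z → ℝ)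
    (z : Z) : ℝ :=
  ∑ u, PU u * twQU K Q u z

def twG {U V L : Type*} [Fintype L] (PU : U → ℝ) (K : U → V → ℝ) (g : U × (L → V)) : ℝ :=
  PU g.1 * ∏ k, K g.1 (g.2 k)

lemma tw_QU_nonneg {U V Z : Type*} [Fintype V] [Fintype Z] {K : U → V → ℝ} {Q : V → Z → ℝ}
    (hK : IsChannel K) (hQ : IsChannel Q) (u : U) (z : Z) : 0 ≤ twQU K Q u z :=
  Finset.sum_nonneg fun v _ => mul_nonneg ((hK u).1 v) ((hQ v).1 z)

lemma tw_QU_chan {U V Z : Type*} [Fintype V] [Fintype Z] {K : U → V → ℝ} {Q : V → Z → ℝ}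
    (hK : IsChannel K) (hQ : IsChannel Q) : IsChannel (twQU K Q) := by
  intro u
  refine ⟨tw_QU_nonneg hK hQ u, ?_⟩
  unfold twQU
  rw [Finset.sum_comm]
  simp only [← Finset.mul_sum, (hQ _).2, mul_one, (hK u).2]

lemma tw_QP_pmf {U V Z : Type*} [Fintype U] [Fintype V] [Fintype Z] {PU : U → ℝ} {K : U → V → ℝ}
    {Q : V → Z → ℝ} (hPU : IsPMF PU) (hK : IsChannel K) (hQ : IsChannel Q) :
    IsPMF (twQP PU K Q) := by
  refine ⟨fun z => Finset.sum_nonneg fun u _ => mul_nonneg (hPU.1 u) (tw_QU_nonneg hK hQ u z), ?_⟩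
  unfold twQP
  rw [Finset.sum_comm]
  simp only [← Finset.mul_sum, (tw_QU_chan hK hQ _).2, mul_one, hPU.2]

lemma tw_QU_pos {U V Z : Type*} [Fintype V] [Fintype Z] {K : U → V → ℝ} {Q : V → Z → ℝ}
    (hK : IsChannel K) (hQ : IsChannel Q) {u : U} {v : V} {z : Z} (h1 : 0 < K u v) (h2 : 0 < Q v z) :
    0 < twQU K Q u z :=
  lt_of_lt_of_le (mul_pos h1 h2) (Finset.single_le_sum (f := fun v => K u v * Q v z)
    (fun v _ => mul_nonneg ((hK u).1 v) ((hQ v).1 z)) (Finset.mem_univ v))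

lemma tw_QP_pos {U V Z : Type*} [Fintype U] [Fintype V] [Fintype Z] {PU : U → ℝ} {K : U → V → ℝ}
    {Q : V → Z → ℝ} (hPU : IsPMF PU) (hK : IsChannel K) (hQ : IsChannel Q) {u : U} {z : Z}
    (h1 : 0 < PU u) (h2 : 0 < twQU K Q u z) :
    0 < twQP PU K Q z :=
  lt_of_lt_of_le (mul_pos h1 h2) (Finset.single_le_sum (f := fun u => PU u * twQU K Q u z)
    (fun u _ => mul_nonneg (hPU.1 u) (tw_QU_nonneg hK hQ u z)) (Finset.mem_univ u))

lemma tw_G_nonneg {U V L : Type*} [Fintype U] [Fintype V] [Fintype L] {PU : U → ℝ} {K : U → V → ℝ}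
    (hPU : IsPMF PU) (hK : IsChannel K) (g : U × (L → V)) : 0 ≤ twG PU K g :=
  mul_nonneg (hPU.1 _) (Finset.prod_nonneg fun _ _ => (hK _).1 _)

lemma tw_G_sum {U V L : Type*} [Fintype U] [Fintype V] [Fintype L] [DecidableEq L] {PU : U → ℝ}
    {K : U → V → ℝ} (f : U × (L → V) → ℝ) :
    ∑ g, twG PU K g * f g = ∑ u, PU u * ∑ v : L → V, (∏ k, K u (v k)) * f (u, v) := by
  rw [Fintype.sum_prod_type]
  refine Finset.sum_congr rfl fun u _ => ?_
  rw [Finset.mul_sum]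
  refine Finset.sum_congr rfl fun v _ => ?_
  simp only [twG]; ring

lemma tw_G_one {U V L : Type*} [Fintype U] [Fintype V] [Fintype L] [DecidableEq L] {PU : U → ℝ}
    {K : U → V → ℝ} (hPU : IsPMF PU) (hK : IsChannel K) :
    ∑ g : U × (L → V), twG PU K g = 1 := by
  have := tw_G_sum (PU := PU) (K := K) (L := L) (fun _ => 1)
  simp only [mul_one] at this
  rw [this]
  have h : ∀ u, ∑ v : L → V, ∏ k, K u (v k) = 1 := fun u => by
    rw [tw_sum_pi (fun (_ : L) v => K u v)]
    simp [(hK u).2]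
  simp [h, hPU.2]

lemma tw_G1 {U V L : Type*} [Fintype U] [Fintype V] [Fintype L] [DecidableEq L] {PU : U → ℝ}
    {K : U → V → ℝ} (hK : IsChannel K) (k : L) (f : U → V → ℝ) :
    ∑ g : U × (L → V), twG PU K g * f g.1 (g.2 k) = ∑ u, PU u * ∑ v, K u v * f u v := by
  rw [tw_G_sum (fun g => f g.1 (g.2 k))]
  refine Finset.sum_congr rfl fun u _ => ?_
  rw [tw_marg1 (K u) (hK u).2 k (f u)]

lemma tw_G2 {U V L : Type*} [Fintype U] [Fintype V] [Fintype L] [DecidableEq L] {PU : U → ℝ}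
    {K : U → V → ℝ} (hK : IsChannel K) (k k' : L) (hk : k ≠ k') (f h : U → V → ℝ) :
    ∑ g : U × (L → V), twG PU K g * (f g.1 (g.2 k) * h g.1 (g.2 k'))
      = ∑ u, PU u * ((∑ v, K u v * f u v) * (∑ v, K u v * h u v)) := by
  rw [tw_G_sum (fun g => f g.1 (g.2 k) * h g.1 (g.2 k'))]
  refine Finset.sum_congr rfl fun u _ => ?_
  rw [tw_marg2 (K u) (hK u).2 k k' hk (f u) (h u)]

lemma tw_soft1 {U V Z I L S : Type*} [Fintype U] [Fintype V] [Fintype Z] [Fintype I]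
    [DecidableEq I] [Fintype L] [DecidableEq L] [Fintype S] [Nonempty S]
    {PU : U → ℝ} {K : U → V → ℝ} {Q : V → Z → ℝ}
    (hPU : IsPMF PU) (hK : IsChannel K) (hQ : IsChannel Q)
    (i : I) (k : S → L) (hk : Function.Injective k) :
    ∑ c : I → U × (L → V), (∏ i, twG PU K (c i)) *
      ∑ z, ((Fintype.card S : ℝ)⁻¹ * ∑ s, Q ((c i).2 (k s)) z) *
        Real.logb 2 (((Fintype.card S : ℝ)⁻¹ * ∑ s, Q ((c i).2 (k s)) z) / twQU K Q (c i).1 z)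
    ≤ ∑ u, ∑ v, ∑ z, PU u * K u v * Q v z * Real.logb 2 ((twQU K Q u z)⁻¹ *
        ((Fintype.card S : ℝ)⁻¹ * Q v z + twQU K Q u z)) := by
  rw [tw_marg1 (twG PU K) (tw_G_one hPU hK) i (fun g =>
     ∑ z, ((Fintype.card S : ℝ)⁻¹ * ∑ s, Q (g.2 (k s)) z) *
        Real.logb 2 (((Fintype.card S : ℝ)⁻¹ * ∑ s, Q (g.2 (k s)) z) / twQU K Q g.1 z))]
  rw [tw_G_sum]
  refine Finset.sum_le_sum fun u _ => ?_
  have e : ∀ v, ∑ z, PU u * K u v * Q v z * Real.logb 2 ((twQU K Q u z)⁻¹ *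
        ((Fintype.card S : ℝ)⁻¹ * Q v z + twQU K Q u z)) =
        PU u * ∑ z, K u v * (Q v z * Real.logb 2 ((twQU K Q u z)⁻¹ *
        ((Fintype.card S : ℝ)⁻¹ * Q v z + twQU K Q u z))) := by
    intro v
    rw [Finset.mul_sum]
    exact Finset.sum_congr rfl fun z _ => by ring
  simp only [e]
  rw [← Finset.mul_sum]
  refine mul_le_mul_of_nonneg_left ?_ (hPU.1 u)
  simp only [Finset.mul_sum (s := (Finset.univ : Finset Z))]
  refine (Finset.sum_comm.le).trans (le_trans ?_ Finset.sum_comm.le)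
  refine Finset.sum_le_sum fun z _ => ?_
  have := tw_jensen (K u) (hK u).1 (hK u).2 (fun v => Q v z) (fun v => (hQ v).1 z) k hk 0
    (twQU K Q u z)⁻¹ le_rfl (inv_nonneg.mpr (tw_QU_nonneg hK hQ u z))
  simp only [zero_add] at this
  refine le_trans (le_of_eq ?_) this
  refine Finset.sum_congr rfl fun c _ => ?_
  congr 3
  rw [div_eq_mul_inv, mul_comm]

lemma tw_soft2 {U V Z I L S T : Type*} [Fintype U] [Fintype V] [Fintype Z] [Fintype I]
    [DecidableEq I] [Fintype L] [DecidableEq L] [Fintype S] [Nonempty S] [Fintype T] [Nonempty T]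
    {PU : U → ℝ} {K : U → V → ℝ} {Q : V → Z → ℝ}
    (hPU : IsPMF PU) (hK : IsChannel K) (hQ : IsChannel Q)
    (j : T → I) (hj : Function.Injective j) (k : S → L) (hk : Function.Injective k) :
    ∑ c : I → U × (L → V), (∏ i, twG PU K (c i)) *
      ∑ z, ((Fintype.card T : ℝ)⁻¹ * ∑ t, ((Fintype.card S : ℝ)⁻¹ * ∑ s, Q ((c (j t)).2 (k s)) z)) *
        Real.logb 2 (((Fintype.card T : ℝ)⁻¹ *
          ∑ t, ((Fintype.card S : ℝ)⁻¹ * ∑ s, Q ((c (j t)).2 (k s)) z)) / twQP PU K Q z)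
    ≤ ∑ u, ∑ v, ∑ z, PU u * K u v * Q v z * Real.logb 2 (1 + (twQP PU K Q z)⁻¹ *
        (Fintype.card T : ℝ)⁻¹ * ((Fintype.card S : ℝ)⁻¹ * Q v z + twQU K Q u z)) := by
  have hQP := tw_QP_pmf hPU hK hQ
  have hR : ∑ u, ∑ v, ∑ z, PU u * K u v * Q v z * Real.logb 2 (1 + (twQP PU K Q z)⁻¹ *
        (Fintype.card T : ℝ)⁻¹ * ((Fintype.card S : ℝ)⁻¹ * Q v z + twQU K Q u z)) =
      ∑ z, ∑ u, PU u * ∑ v, K u v * (Q v z * Real.logb 2 (1 + (twQP PU K Q z)⁻¹ *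
        (Fintype.card T : ℝ)⁻¹ * ((Fintype.card S : ℝ)⁻¹ * Q v z + twQU K Q u z))) := by
    conv_rhs => rw [Finset.sum_comm]
    refine Finset.sum_congr rfl fun u _ => ?_
    simp only [Finset.mul_sum]
    rw [Finset.sum_comm]
    exact Finset.sum_congr rfl fun z _ => Finset.sum_congr rfl fun v _ => by ring
  rw [hR]
  simp only [Finset.mul_sum (s := (Finset.univ : Finset Z))]
  rw [Finset.sum_comm]
  refine Finset.sum_le_sum fun z _ => ?_
  set F : U × (L → V) → ℝ := fun g => (Fintype.card S : ℝ)⁻¹ * ∑ s, Q (g.2 (k s)) z with hF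
  have hF0 : ∀ g, 0 ≤ F g := fun g =>
    mul_nonneg (by positivity) (Finset.sum_nonneg fun s _ => (hQ _).1 z)
  have hFE : ∑ g, twG PU K g * F g = twQP PU K Q z := by
    have : ∀ s, ∑ g : U × (L → V), twG PU K g * Q (g.2 (k s)) z = twQP PU K Q z := fun s => by
      rw [tw_G1 hK (k s) (fun _ v => Q v z)]; rfl
    calc _ = (Fintype.card S : ℝ)⁻¹ * ∑ s, ∑ g : U × (L → V), twG PU K g * Q (g.2 (k s)) z := by
          rw [Finset.sum_comm, Finset.mul_sum]
          refine Finset.sum_congr rfl fun g _ => ?_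
          rw [← Finset.mul_sum]; simp only [hF]; ring
      _ = _ := by
          simp only [this]
          rw [Finset.sum_const, nsmul_eq_mul, Finset.card_univ, inv_mul_cancel_left₀]
          have : 0 < Fintype.card S := Fintype.card_pos
          positivity
  have h1 := tw_jensen (twG PU K) (tw_G_nonneg hPU hK) (tw_G_one hPU hK) F hF0 j hj 0
    (twQP PU K Q z)⁻¹ le_rfl (inv_nonneg.mpr (hQP.1 z))
  rw [hFE] at h1
  have h0 : ∀ c : I → U × (L → V), (∏ i, twG PU K (c i)) * (((Fintype.card T : ℝ)⁻¹ * ∑ t, F (c (j t))) *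
      Real.logb 2 (0 + (twQP PU K Q z)⁻¹ * ((Fintype.card T : ℝ)⁻¹ * ∑ t, F (c (j t))))) =
      (∏ i, twG PU K (c i)) * (((Fintype.card T : ℝ)⁻¹ *
        ∑ t, ((Fintype.card S : ℝ)⁻¹ * ∑ s, Q ((c (j t)).2 (k s)) z)) *
        Real.logb 2 (((Fintype.card T : ℝ)⁻¹ *
          ∑ t, ((Fintype.card S : ℝ)⁻¹ * ∑ s, Q ((c (j t)).2 (k s)) z)) / twQP PU K Q z)) := by
    intro c
    rw [zero_add, div_eq_mul_inv, mul_comm (twQP PU K Q z)⁻¹]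
  simp only [h0] at h1
  refine h1.trans ?_
  have h2 : ∀ g, F g * Real.logb 2 (0 + (twQP PU K Q z)⁻¹ *
      ((Fintype.card T : ℝ)⁻¹ * F g + twQP PU K Q z)) =
      F g * Real.logb 2 (1 + ((twQP PU K Q z)⁻¹ * (Fintype.card T : ℝ)⁻¹) * F g) := by
    intro g
    by_cases hz : twQP PU K Q z = 0
    · simp [hz]
    · congr 2
      field_simp
      ring
  simp only [h2]
  rw [tw_G_sum]
  refine Finset.sum_le_sum fun u _ => mul_le_mul_of_nonneg_left ?_ (hPU.1 u)
  have := tw_jensen (K u) (hK u).1 (hK u).2 (fun v => Q v z) (fun v => (hQ v).1 z) k hk 1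
    ((twQP PU K Q z)⁻¹ * (Fintype.card T : ℝ)⁻¹) zero_le_one
    (mul_nonneg (inv_nonneg.mpr (hQP.1 z)) (by positivity))
  exact this

lemma tw_err {U V Y I L : Type*} [Fintype U] [Fintype V] [Fintype Y] [Fintype I]
    [DecidableEq I] [Fintype L] [DecidableEq L]
    {PU : U → ℝ} {K : U → V → ℝ} {Q : V → Y → ℝ}
    (hPU : IsPMF PU) (hK : IsChannel K) (hQ : IsChannel Q) (τ : U → V → Y → ℝ)
    (γ₁ γ₂ : ℝ) (hγ₁ : 0 < γ₁) (hγ₂ : 0 < γ₂)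
    (h1 : ∀ u v y, τ u v y * (γ₁ * twQU K Q u y) ≤ Q v y)
    (h2 : ∀ u v y, τ u v y * (γ₂ * twQP PU K Q y) ≤ Q v y) (hτ : ∀ u v y, 0 ≤ τ u v y)
    (i : I) (k : L) :
    ∑ c : I → U × (L → V), (∏ i, twG PU K (c i)) *
      ∑ y, Q ((c i).2 k) y * ((1 - τ (c i).1 ((c i).2 k) y)
        + ∑ k' ∈ Finset.univ.erase k, τ (c i).1 ((c i).2 k') y
        + ∑ i' ∈ Finset.univ.erase i, ∑ k', τ (c i').1 ((c i').2 k') y)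
    ≤ ∑ u, ∑ v, ∑ y, PU u * K u v * Q v y * (1 - τ u v y)
      + Fintype.card L * γ₁⁻¹ + Fintype.card I * Fintype.card L * γ₂⁻¹ := by
  have hw0 := tw_G_one (L := L) hPU hK
  have hQP := tw_QP_pmf hPU hK hQ
  have hA : ∑ c : I → U × (L → V), (∏ i, twG PU K (c i)) *
      ∑ y, Q ((c i).2 k) y * (1 - τ (c i).1 ((c i).2 k) y) =
      ∑ u, ∑ v, ∑ y, PU u * K u v * Q v y * (1 - τ u v y) := by
    rw [tw_marg1 (twG PU K) hw0 i (fun g => ∑ y, Q (g.2 k) y * (1 - τ g.1 (g.2 k) y)),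
      tw_G1 hK k (fun u v => ∑ y, Q v y * (1 - τ u v y))]
    simp only [Finset.mul_sum]
    refine Finset.sum_congr rfl fun u _ => Finset.sum_congr rfl fun v _ =>
      Finset.sum_congr rfl fun y _ => by ring
  have hB : ∀ k' ∈ Finset.univ.erase k, ∑ c : I → U × (L → V), (∏ i, twG PU K (c i)) *
      ∑ y, Q ((c i).2 k) y * τ (c i).1 ((c i).2 k') y ≤ γ₁⁻¹ := by
    intro k' hk'
    have hne : k ≠ k' := fun h => (Finset.mem_erase.mp hk').1 h.symm
    rw [tw_marg1 (twG PU K) hw0 i (fun g => ∑ y, Q (g.2 k) y * τ g.1 (g.2 k') y)]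
    simp only [Finset.mul_sum]
    rw [Finset.sum_comm]
    have e : ∀ y, ∑ g : U × (L → V), twG PU K g * (Q (g.2 k) y * τ g.1 (g.2 k') y) =
      ∑ u, PU u * ∑ v, K u v * (τ u v y * twQU K Q u y) := by
      intro y
      rw [tw_G2 hK k k' hne (fun _ v => Q v y) (fun u v => τ u v y)]
      refine Finset.sum_congr rfl fun u _ => ?_
      congr 1
      change twQU K Q u y * _ = _
      rw [Finset.mul_sum]
      exact Finset.sum_congr rfl fun v _ => by ring
    simp only [e]
    calc _ ≤ ∑ y, ∑ u, PU u * ∑ v, K u v * (γ₁⁻¹ * Q v y) := by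
          refine Finset.sum_le_sum fun y _ => Finset.sum_le_sum fun u _ => ?_
          refine mul_le_mul_of_nonneg_left (Finset.sum_le_sum fun v _ => ?_) (hPU.1 u)
          refine mul_le_mul_of_nonneg_left ?_ ((hK u).1 v)
          have := h1 u v y
          rw [inv_mul_eq_div, le_div_iff₀ hγ₁]
          linarith
      _ = γ₁⁻¹ * ∑ y, twQP PU K Q y := by
          simp only [twQP, twQU, Finset.mul_sum]
          refine Finset.sum_congr rfl fun y _ => Finset.sum_congr rfl fun u _ =>
            Finset.sum_congr rfl fun v _ => by ring
      _ = γ₁⁻¹ := by rw [hQP.2, mul_one]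
  have hC : ∀ i' ∈ Finset.univ.erase i, ∀ k', ∑ c : I → U × (L → V), (∏ i, twG PU K (c i)) *
      ∑ y, Q ((c i).2 k) y * τ (c i').1 ((c i').2 k') y ≤ γ₂⁻¹ := by
    intro i' hi' k'
    have hne : i ≠ i' := fun h => (Finset.mem_erase.mp hi').1 h.symm
    simp only [Finset.mul_sum]
    rw [Finset.sum_comm]
    have e : ∀ y, ∑ c : I → U × (L → V), (∏ i, twG PU K (c i)) *
        (Q ((c i).2 k) y * τ (c i').1 ((c i').2 k') y) =
      ∑ u, PU u * ∑ v, K u v * (τ u v y * twQP PU K Q y) := by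
      intro y
      rw [tw_marg2 (twG PU K) hw0 i i' hne (fun g => Q (g.2 k) y) (fun g => τ g.1 (g.2 k') y),
        tw_G1 hK k (fun _ v => Q v y), tw_G1 hK k' (fun u v => τ u v y)]
      change twQP PU K Q y * _ = _
      rw [Finset.mul_sum]
      refine Finset.sum_congr rfl fun u _ => ?_
      rw [mul_left_comm, Finset.mul_sum]
      congr 1
      exact Finset.sum_congr rfl fun v _ => by ring
    simp only [e]
    calc _ ≤ ∑ y, ∑ u, PU u * ∑ v, K u v * (γ₂⁻¹ * Q v y) := by
          refine Finset.sum_le_sum fun y _ => Finset.sum_le_sum fun u _ => ?_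
          refine mul_le_mul_of_nonneg_left (Finset.sum_le_sum fun v _ => ?_) (hPU.1 u)
          refine mul_le_mul_of_nonneg_left ?_ ((hK u).1 v)
          have := h2 u v y
          rw [inv_mul_eq_div, le_div_iff₀ hγ₂]
          linarith
      _ = γ₂⁻¹ * ∑ y, twQP PU K Q y := by
          simp only [twQP, twQU, Finset.mul_sum]
          refine Finset.sum_congr rfl fun y _ => Finset.sum_congr rfl fun u _ =>
            Finset.sum_congr rfl fun v _ => by ring
      _ = γ₂⁻¹ := by rw [hQP.2, mul_one]
  have split : ∀ c : I → U × (L → V), (∏ i, twG PU K (c i)) *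
      ∑ y, Q ((c i).2 k) y * ((1 - τ (c i).1 ((c i).2 k) y)
        + ∑ k' ∈ Finset.univ.erase k, τ (c i).1 ((c i).2 k') y
        + ∑ i' ∈ Finset.univ.erase i, ∑ k', τ (c i').1 ((c i').2 k') y) =
      (∏ i, twG PU K (c i)) * (∑ y, Q ((c i).2 k) y * (1 - τ (c i).1 ((c i).2 k) y))
      + ∑ k' ∈ Finset.univ.erase k, (∏ i, twG PU K (c i)) *
        ∑ y, Q ((c i).2 k) y * τ (c i).1 ((c i).2 k') y
      + ∑ i' ∈ Finset.univ.erase i, ∑ k', (∏ i, twG PU K (c i)) *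
        ∑ y, Q ((c i).2 k) y * τ (c i').1 ((c i').2 k') y := by
    intro c
    simp only [← Finset.mul_sum]
    rw [← mul_add, ← mul_add]
    congr 1
    have h' : ∑ k' ∈ Finset.univ.erase k, ∑ y, Q ((c i).2 k) y * τ (c i).1 ((c i).2 k') y
      = ∑ y, Q ((c i).2 k) y * ∑ k' ∈ Finset.univ.erase k, τ (c i).1 ((c i).2 k') y := by
      simp only [Finset.mul_sum]
      rw [Finset.sum_comm]
    have : ∑ i' ∈ Finset.univ.erase i, ∑ k', ∑ y, Q ((c i).2 k) y * τ (c i').1 ((c i').2 k') y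
      = ∑ y, Q ((c i).2 k) y * ∑ i' ∈ Finset.univ.erase i, ∑ k', τ (c i').1 ((c i').2 k') y := by
      simp only [Finset.mul_sum]
      conv_rhs => rw [Finset.sum_comm]
      refine Finset.sum_congr rfl fun i' _ => ?_
      rw [Finset.sum_comm]
    rw [this, h']
    rw [← Finset.sum_add_distrib, ← Finset.sum_add_distrib]
    exact Finset.sum_congr rfl fun y _ => by ring
  simp only [split, Finset.sum_add_distrib]
  rw [hA]
  refine add_le_add (add_le_add le_rfl ?_) ?_
  · rw [Finset.sum_comm]
    refine (Finset.sum_le_sum hB).trans ?_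
    rw [Finset.sum_const, nsmul_eq_mul]
    gcongr
    exact Finset.card_le_univ _
  · rw [Finset.sum_comm]
    have : ∀ i' ∈ Finset.univ.erase i, ∑ c : I → U × (L → V), ∑ k', (∏ i, twG PU K (c i)) *
        ∑ y, Q ((c i).2 k) y * τ (c i').1 ((c i').2 k') y ≤ Fintype.card L * γ₂⁻¹ := by
      intro i' hi'
      rw [Finset.sum_comm]
      refine (Finset.sum_le_sum fun k' _ => hC i' hi' k').trans ?_
      rw [Finset.sum_const, nsmul_eq_mul, Finset.card_univ]
    refine (Finset.sum_le_sum this).trans ?_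
    rw [Finset.sum_const, nsmul_eq_mul, mul_assoc]
    gcongr
    exact Finset.card_le_univ _

/-- output distribution at the weak eavesdropper given a message -/
def twP2 {U V Z M A B T S : Type*} [Fintype T] [Fintype S] (Q : V → Z → ℝ)
    (c : A × T → U × (M × B × S → V)) (m : M) (a : A) (b : B) (z : Z) : ℝ :=
  (Fintype.card T : ℝ)⁻¹ * ∑ t, ((Fintype.card S : ℝ)⁻¹ * ∑ s, Q ((c (a, t)).2 (m, b, s)) z)

def twP1 {U V Z M A B T S : Type*} [Fintype B] [Fintype S] (Q : V → Z → ℝ)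
    (c : A × T → U × (M × B × S → V)) (m : M) (i : A × T) (z : Z) : ℝ :=
  (Fintype.card (B × S) : ℝ)⁻¹ * ∑ s : B × S, Q ((c i).2 (m, s)) z

def twD2 {U V Z M A B T S : Type*} [Fintype U] [Fintype V] [Fintype Z]
    [Fintype M] [Fintype A] [Fintype B] [Fintype T] [Fintype S]
    (PU : U → ℝ) (K : U → V → ℝ) (Q : V → Z → ℝ)
    (c : A × T → U × (M × B × S → V)) : ℝ :=
  (Fintype.card (M × A × B) : ℝ)⁻¹ * ∑ x : M × A × B, ∑ z, twP2 Q c x.1 x.2.1 x.2.2 z *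
    Real.logb 2 (twP2 Q c x.1 x.2.1 x.2.2 z / twQP PU K Q z)

def twD1 {U V Z M A B T S : Type*} [Fintype V] [Fintype Z]
    [Fintype M] [Fintype A] [Fintype B] [Fintype T] [Fintype S]
    (K : U → V → ℝ) (Q : V → Z → ℝ)
    (c : A × T → U × (M × B × S → V)) : ℝ :=
  (Fintype.card (M × A × T) : ℝ)⁻¹ * ∑ x : M × A × T, ∑ z, twP1 Q c x.1 x.2 z *
    Real.logb 2 (twP1 Q c x.1 x.2 z / twQU K Q (c x.2).1 z)

def twErr {U V Y I L : Type*} [Fintype Y] [Fintype I] [Fintype L] [DecidableEq I] [DecidableEq L]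
    (Q : V → Y → ℝ) (c : I → U × (L → V)) (dec : Y → I × L) : ℝ :=
  (Fintype.card (I × L) : ℝ)⁻¹ * ∑ x : I × L, ∑ y, Q ((c x.1).2 x.2) y *
    (if dec y ≠ x then 1 else 0)

lemma tw_avg {C X : Type*} [Fintype C] [Fintype X] [Nonempty X] (w : C → ℝ) (f : X → C → ℝ) (b : ℝ)
    (h : ∀ x, ∑ c, w c * f x c ≤ b) :
    ∑ c, w c * ((Fintype.card X : ℝ)⁻¹ * ∑ x, f x c) ≤ b := by
  have hX : (0:ℝ) < Fintype.card X := by exact_mod_cast Fintype.card_pos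
  calc _ = (Fintype.card X : ℝ)⁻¹ * ∑ x, ∑ c, w c * f x c := by
        rw [Finset.sum_comm, Finset.mul_sum]
        refine Finset.sum_congr rfl fun c _ => ?_
        rw [← Finset.mul_sum]; ring
    _ ≤ (Fintype.card X : ℝ)⁻¹ * ∑ x : X, b := by gcongr with x; exact h x
    _ = b := by
        rw [Finset.sum_const, nsmul_eq_mul, Finset.card_univ, inv_mul_cancel_left₀ hX.ne']

lemma tw_pick {C : Type*} [Fintype C] (w : C → ℝ) (hw0 : ∀ c, 0 ≤ w c) (hw : ∑ c, w c = 1)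
    (f : C → ℝ) (b : ℝ) (h : ∑ c, w c * f c ≤ b) : ∃ c, 0 < w c ∧ f c ≤ b := by
  by_contra hcon
  push Not at hcon
  have h1 : ∀ c, w c * b ≤ w c * f c := fun c => by
    rcases (hw0 c).eq_or_lt with h0 | h0
    · simp [← h0]
    · exact mul_le_mul_of_nonneg_left (hcon c h0).le h0.le
  obtain ⟨c, _, hc⟩ := Finset.exists_lt_of_sum_lt (f := fun _ => (0:ℝ)) (g := w) (s := Finset.univ)
    (by simp [hw])
  have : ∑ c, w c * b < ∑ c, w c * f c :=
    Finset.sum_lt_sum (fun c _ => h1 c)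
      ⟨c, Finset.mem_univ c, mul_lt_mul_of_pos_left (hcon c hc) hc⟩
  rw [← Finset.sum_mul, hw, one_mul] at this
  linarith

open Classical in
lemma tw_oneshot {U V Y Z₁ Z₂ M A B T S : Type*} [Fintype U] [Fintype V] [Fintype Y]
    [Fintype Z₁] [Fintype Z₂]
    [Fintype M] [Fintype A] [Fintype B] [Fintype T] [Fintype S]
    [DecidableEq M] [DecidableEq A] [DecidableEq B] [DecidableEq T] [DecidableEq S]
    [Nonempty M] [Nonempty A] [Nonempty B] [Nonempty T] [Nonempty S]
    {PU : U → ℝ} {K : U → V → ℝ} {QY : V → Y → ℝ} {Q₁ : V → Z₁ → ℝ} {Q₂ : V → Z₂ → ℝ}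
    (hPU : IsPMF PU) (hK : IsChannel K) (hQY : IsChannel QY) (hQ₁ : IsChannel Q₁)
    (hQ₂ : IsChannel Q₂) (γ₁ γ₂ lam mu : ℝ) (hγ₁ : 0 < γ₁) (hγ₂ : 0 < γ₂) (hlam : 0 ≤ lam)
    (hmu : 0 ≤ mu) :
    ∃ (c : A × T → U × (M × B × S → V)) (dec : Y → (A × T) × (M × B × S)),
      (∀ i, 0 < PU (c i).1) ∧ (∀ i l, 0 < K (c i).1 ((c i).2 l)) ∧
      twErr QY c dec + lam * twD2 PU K Q₂ c + mu * twD1 K Q₁ c ≤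
      (∑ u, ∑ v, ∑ y, PU u * K u v * QY v y *
          (if γ₁ * twQU K QY u y < QY v y ∧ γ₂ * twQP PU K QY y < QY v y then 0 else 1)
        + Fintype.card (M × B × S) * γ₁⁻¹
        + Fintype.card (A × T) * Fintype.card (M × B × S) * γ₂⁻¹)
      + lam * (∑ u, ∑ v, ∑ z, PU u * K u v * Q₂ v z * Real.logb 2 (1 + (twQP PU K Q₂ z)⁻¹ *
        (Fintype.card T : ℝ)⁻¹ * ((Fintype.card S : ℝ)⁻¹ * Q₂ v z + twQU K Q₂ u z)))
      + mu * (∑ u, ∑ v, ∑ z, PU u * K u v * Q₁ v z * Real.logb 2 ((twQU K Q₁ u z)⁻¹ *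
        ((Fintype.card (B × S) : ℝ)⁻¹ * Q₁ v z + twQU K Q₁ u z))) := by
  set τ : U → V → Y → ℝ := fun u v y =>
    if γ₁ * twQU K QY u y < QY v y ∧ γ₂ * twQP PU K QY y < QY v y then 1 else 0 with hτdef
  have hτ0 : ∀ u v y, 0 ≤ τ u v y := fun u v y => by simp only [hτdef]; split_ifs <;> norm_num
  have hτ1 : ∀ u v y, τ u v y * (γ₁ * twQU K QY u y) ≤ QY v y := fun u v y => by
    simp only [hτdef]; split_ifs with h
    · linarith [h.1]
    · simpa using (hQY v).1 y
  have hτ2 : ∀ u v y, τ u v y * (γ₂ * twQP PU K QY y) ≤ QY v y := fun u v y => by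
    simp only [hτdef]; split_ifs with h
    · linarith [h.2]
    · simpa using (hQY v).1 y
  have hτ3 : ∀ u v y, (if γ₁ * twQU K QY u y < QY v y ∧ γ₂ * twQP PU K QY y < QY v y then (0:ℝ) else 1)
     = 1 - τ u v y := fun u v y => by simp only [hτdef]; split_ifs <;> norm_num
  let dec : (A × T → U × (M × B × S → V)) → Y → (A × T) × (M × B × S) := fun c y =>
    if h : ∃ x : (A × T) × (M × B × S), τ (c x.1).1 ((c x.1).2 x.2) y = 1 then h.choose
    else Classical.arbitrary _
  have hdec : ∀ c y x, (if dec c y ≠ x then (1:ℝ) else 0) ≤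
      (1 - τ (c x.1).1 ((c x.1).2 x.2) y)
        + ∑ k' ∈ Finset.univ.erase x.2, τ (c x.1).1 ((c x.1).2 k') y
        + ∑ i' ∈ Finset.univ.erase x.1, ∑ k', τ (c i').1 ((c i').2 k') y := by
    intro c y x
    have n0 : 0 ≤ 1 - τ (c x.1).1 ((c x.1).2 x.2) y := by rw [← hτ3]; split_ifs <;> norm_num
    have n1 : 0 ≤ ∑ k' ∈ Finset.univ.erase x.2, τ (c x.1).1 ((c x.1).2 k') y :=
      Finset.sum_nonneg fun k' _ => hτ0 _ _ _
    have n2 : 0 ≤ ∑ i' ∈ Finset.univ.erase x.1, ∑ k', τ (c i').1 ((c i').2 k') y :=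
      Finset.sum_nonneg fun i' _ => Finset.sum_nonneg fun k' _ => hτ0 _ _ _
    split_ifs with hne
    · by_cases hx : τ (c x.1).1 ((c x.1).2 x.2) y = 1
      · have hex : ∃ x : (A × T) × (M × B × S), τ (c x.1).1 ((c x.1).2 x.2) y = 1 := ⟨x, hx⟩
        have hd : dec c y = hex.choose := dif_pos hex
        have hsp := hex.choose_spec
        rw [← hd] at hsp
        by_cases h1 : (dec c y).1 = x.1
        · have h2 : (dec c y).2 ≠ x.2 := fun h2 => hne (Prod.ext h1 h2)
          have := Finset.single_le_sum (f := fun k' => τ (c x.1).1 ((c x.1).2 k') y)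
            (s := Finset.univ.erase x.2) (fun k' _ => hτ0 _ _ _)
            (Finset.mem_erase.mpr ⟨h2, Finset.mem_univ _⟩)
          rw [← h1, hsp] at this
          rw [h1] at this
          linarith
        · have := Finset.single_le_sum (f := fun i' => ∑ k', τ (c i').1 ((c i').2 k') y)
            (s := Finset.univ.erase x.1) (fun i' _ => Finset.sum_nonneg fun k' _ => hτ0 _ _ _)
            (Finset.mem_erase.mpr ⟨h1, Finset.mem_univ _⟩)
          have h3 := Finset.single_le_sum
            (f := fun k' => τ (c (dec c y).1).1 ((c (dec c y).1).2 k') y)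
            (s := Finset.univ) (fun k' _ => hτ0 _ _ _) (Finset.mem_univ (dec c y).2)
          rw [hsp] at h3
          linarith
      · have : 1 - τ (c x.1).1 ((c x.1).2 x.2) y = 1 := by
          rw [← hτ3]
          rw [if_neg]
          intro h; apply hx; simp only [hτdef]; rw [if_pos h]
        linarith
    · linarith
  simp only [hτ3]
  set w : (A × T → U × (M × B × S → V)) → ℝ := fun c => ∏ i, twG PU K (c i) with hw
  have hw0 : ∀ c, 0 ≤ w c := fun c => Finset.prod_nonneg fun i _ => tw_G_nonneg hPU hK _
  have hw1 : ∑ c, w c = 1 := by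
    simp only [hw]
    rw [tw_sum_pi (fun _ g => twG PU K g), tw_G_one hPU hK]; simp
  have E1 : ∑ c, w c * twErr QY c (dec c) ≤
      ∑ u, ∑ v, ∑ y, PU u * K u v * QY v y * (1 - τ u v y)
        + Fintype.card (M × B × S) * γ₁⁻¹
        + Fintype.card (A × T) * Fintype.card (M × B × S) * γ₂⁻¹ := by
    unfold twErr
    refine tw_avg w (fun x c => ∑ y, QY ((c x.1).2 x.2) y *
      (if dec c y ≠ x then 1 else 0)) _ fun x => ?_
    refine le_trans ?_ (tw_err hPU hK hQY τ γ₁ γ₂ hγ₁ hγ₂ hτ1 hτ2 hτ0 x.1 x.2)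
    refine Finset.sum_le_sum fun c _ => mul_le_mul_of_nonneg_left ?_ (hw0 c)
    refine Finset.sum_le_sum fun y _ => mul_le_mul_of_nonneg_left ?_ ((hQY _).1 y)
    exact hdec c y x
  have E2 : ∑ c, w c * twD2 PU K Q₂ c ≤
      ∑ u, ∑ v, ∑ z, PU u * K u v * Q₂ v z * Real.logb 2 (1 + (twQP PU K Q₂ z)⁻¹ *
        (Fintype.card T : ℝ)⁻¹ * ((Fintype.card S : ℝ)⁻¹ * Q₂ v z + twQU K Q₂ u z)) := by
    unfold twD2
    refine tw_avg w (fun (x : M × A × B) c => ∑ z, twP2 Q₂ c x.1 x.2.1 x.2.2 z *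
      Real.logb 2 (twP2 Q₂ c x.1 x.2.1 x.2.2 z / twQP PU K Q₂ z)) _ fun x => ?_
    exact tw_soft2 hPU hK hQ₂ (fun t : T => (x.2.1, t)) (fun t t' h => by simpa using h)
      (fun s : S => (x.1, x.2.2, s)) (fun t t' h => by simpa using h)
  have E3 : ∑ c, w c * twD1 K Q₁ c ≤
      ∑ u, ∑ v, ∑ z, PU u * K u v * Q₁ v z * Real.logb 2 ((twQU K Q₁ u z)⁻¹ *
        ((Fintype.card (B × S) : ℝ)⁻¹ * Q₁ v z + twQU K Q₁ u z)) := by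
    unfold twD1
    refine tw_avg w (fun (x : M × A × T) c => ∑ z, twP1 Q₁ c x.1 x.2 z *
      Real.logb 2 (twP1 Q₁ c x.1 x.2 z / twQU K Q₁ (c x.2).1 z)) _ fun x => ?_
    exact tw_soft1 hPU hK hQ₁ x.2
      (fun s : B × S => (x.1, s)) (fun t t' h => by simpa using h)
  have Etot : ∑ c, w c * (twErr QY c (dec c) + lam * twD2 PU K Q₂ c + mu * twD1 K Q₁ c) =
      ∑ c, w c * twErr QY c (dec c) + lam * ∑ c, w c * twD2 PU K Q₂ c
        + mu * ∑ c, w c * twD1 K Q₁ c := by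
    rw [Finset.mul_sum, Finset.mul_sum, ← Finset.sum_add_distrib, ← Finset.sum_add_distrib]
    exact Finset.sum_congr rfl fun c _ => by ring
  obtain ⟨c, hc, hcb⟩ := tw_pick w hw0 hw1 _ _ (Etot.le.trans
    (add_le_add (add_le_add E1 (mul_le_mul_of_nonneg_left E2 hlam))
      (mul_le_mul_of_nonneg_left E3 hmu)))
  have hne : ∀ i, twG PU K (c i) ≠ 0 := fun i h => hc.ne' (Finset.prod_eq_zero (Finset.mem_univ i) h)
  refine ⟨c, dec c, fun i => ?_, fun i l => ?_, hcb⟩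
  · exact lt_of_le_of_ne (hPU.1 _) (Ne.symm (left_ne_zero_of_mul (hne i)))
  · refine lt_of_le_of_ne ((hK _).1 _) (Ne.symm fun h => ?_)
    exact right_ne_zero_of_mul (hne i) (Finset.prod_eq_zero (Finset.mem_univ l) h)

lemma tw_P2_chan {U V Z M A B T S : Type*} [Fintype Z] [Fintype T] [Fintype S] [Nonempty T]
    [Nonempty S] {Q : V → Z → ℝ} (hQ : IsChannel Q)
    (c : A × T → U × (M × B × S → V)) (m : M) (a : A) (b : B) : IsPMF (twP2 Q c m a b) := by
  have hT : (0:ℝ) < Fintype.card T := by exact_mod_cast Fintype.card_pos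
  have hS : (0:ℝ) < Fintype.card S := by exact_mod_cast Fintype.card_pos
  refine ⟨fun z => ?_, ?_⟩
  · exact mul_nonneg (by positivity) (Finset.sum_nonneg fun t _ => mul_nonneg (by positivity)
      (Finset.sum_nonneg fun s _ => (hQ _).1 z))
  · unfold twP2
    rw [← Finset.mul_sum, Finset.sum_comm]
    have : ∀ t, ∑ z, ((Fintype.card S : ℝ)⁻¹ * ∑ s, Q ((c (a, t)).2 (m, b, s)) z) = 1 := by
      intro t
      rw [← Finset.mul_sum, Finset.sum_comm]
      simp only [(hQ _).2]
      simp
    simp [this]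

lemma tw_P1_chan {U V Z M A B T S : Type*} [Fintype Z] [Fintype B] [Fintype S] [Nonempty B]
    [Nonempty S] {Q : V → Z → ℝ} (hQ : IsChannel Q)
    (c : A × T → U × (M × B × S → V)) (m : M) (i : A × T) : IsPMF (twP1 Q c m i) := by
  have hS : (0:ℝ) < Fintype.card (B × S) := by exact_mod_cast Fintype.card_pos
  refine ⟨fun z => ?_, ?_⟩
  · exact mul_nonneg (by positivity) (Finset.sum_nonneg fun s _ => (hQ _).1 z)
  · unfold twP1
    rw [← Finset.mul_sum, Finset.sum_comm]
    simp only [(hQ _).2]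
    rw [Finset.sum_const, Finset.card_univ, nsmul_eq_mul, mul_one, inv_mul_cancel₀ hS.ne']

lemma tw_P2_ac {U V Z M A B T S : Type*} [Fintype U] [Fintype V] [Fintype Z] [Fintype T] [Fintype S]
    {PU : U → ℝ} {K : U → V → ℝ} {Q : V → Z → ℝ}
    (hPU : IsPMF PU) (hK : IsChannel K) (hQ : IsChannel Q)
    (c : A × T → U × (M × B × S → V)) (h1 : ∀ i, 0 < PU (c i).1)
    (h2 : ∀ i l, 0 < K (c i).1 ((c i).2 l)) (m : M) (a : A) (b : B) (z : Z)
    (h : 0 < twP2 Q c m a b z) : 0 < twQP PU K Q z := by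
  have h' := pos_of_mul_pos_right h (by positivity)
  obtain ⟨t, _, ht⟩ := Finset.exists_lt_of_sum_lt (f := fun _ => (0:ℝ))
      (s := Finset.univ) (by simpa using h')
  have h'' := pos_of_mul_pos_right ht (by positivity)
  obtain ⟨s, _, hs⟩ := Finset.exists_lt_of_sum_lt (f := fun _ => (0:ℝ))
      (s := Finset.univ) (by simpa using h'')
  exact tw_QP_pos hPU hK hQ (h1 _) (tw_QU_pos hK hQ (h2 _ _) hs)

lemma tw_P1_ac {U V Z M A B T S : Type*} [Fintype U] [Fintype V] [Fintype Z] [Fintype B] [Fintype S]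
    {K : U → V → ℝ} {Q : V → Z → ℝ} (hK : IsChannel K) (hQ : IsChannel Q)
    (c : A × T → U × (M × B × S → V))
    (h2 : ∀ i l, 0 < K (c i).1 ((c i).2 l)) (m : M) (i : A × T) (z : Z)
    (h : 0 < twP1 Q c m i z) : 0 < twQU K Q (c i).1 z := by
  have h' := pos_of_mul_pos_right h (by positivity)
  obtain ⟨t, _, ht⟩ := Finset.exists_lt_of_sum_lt (f := fun _ => (0:ℝ))
      (s := Finset.univ) (by simpa using h')
  exact tw_QU_pos hK hQ (h2 _ _) ht

lemma tw_D2_nonneg {U V Z M A B T S : Type*} [Fintype U] [Fintype V] [Fintype Z]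
    [Fintype M] [Fintype A] [Fintype B] [Fintype T] [Fintype S] [Nonempty T] [Nonempty S]
    {PU : U → ℝ} {K : U → V → ℝ} {Q : V → Z → ℝ}
    (hPU : IsPMF PU) (hK : IsChannel K) (hQ : IsChannel Q)
    (c : A × T → U × (M × B × S → V)) (h1 : ∀ i, 0 < PU (c i).1)
    (h2 : ∀ i l, 0 < K (c i).1 ((c i).2 l)) : 0 ≤ twD2 PU K Q c := by
  refine mul_nonneg (by positivity) (Finset.sum_nonneg fun x _ => ?_)
  exact tw_kl_nonneg _ _ (tw_P2_chan hQ c x.1 x.2.1 x.2.2).1 (tw_QP_pmf hPU hK hQ).1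
    (tw_P2_ac hPU hK hQ c h1 h2 _ _ _) (tw_P2_chan hQ c x.1 x.2.1 x.2.2).2 (tw_QP_pmf hPU hK hQ).2

lemma tw_D1_nonneg {U V Z M A B T S : Type*} [Fintype U] [Fintype V] [Fintype Z]
    [Fintype M] [Fintype A] [Fintype B] [Fintype T] [Fintype S] [Nonempty B] [Nonempty S]
    {K : U → V → ℝ} {Q : V → Z → ℝ} (hK : IsChannel K) (hQ : IsChannel Q)
    (c : A × T → U × (M × B × S → V))
    (h2 : ∀ i l, 0 < K (c i).1 ((c i).2 l)) : 0 ≤ twD1 K Q c := by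
  refine mul_nonneg (by positivity) (Finset.sum_nonneg fun x _ => ?_)
  exact tw_kl_nonneg _ _ (tw_P1_chan hQ c x.1 x.2).1 (tw_QU_chan hK hQ _).1
    (tw_P1_ac hK hQ c h2 _ _) (tw_P1_chan hQ c x.1 x.2).2 (tw_QU_chan hK hQ _).2

/-- leakage of both messages, in terms of the divergence functional -/
lemma tw_leak2 {U V Z M A B T S N : Type*} [Fintype U] [Fintype V] [Fintype Z]
    [Fintype M] [Fintype A] [Fintype B] [Fintype T] [Fintype S] [Fintype N]
    [Nonempty M] [Nonempty A] [Nonempty B] [Nonempty T] [Nonempty S]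
    {PU : U → ℝ} {K : U → V → ℝ} {Q : V → Z → ℝ}
    (hPU : IsPMF PU) (hK : IsChannel K) (hQ : IsChannel Q)
    (c : A × T → U × (M × B × S → V)) (h1 : ∀ i, 0 < PU (c i).1)
    (h2 : ∀ i l, 0 < K (c i).1 ((c i).2 l)) (e : A × B ≃ N) (κ : ℝ)
    (hκ : κ = (Fintype.card (M × N) : ℝ)⁻¹) :
    mutInfo (fun q : (M × N) × Z => κ * twP2 Q c q.1.1 (e.symm q.1.2).1 (e.symm q.1.2).2 q.2)
      ≤ twD2 PU K Q c := by
  have : Nonempty N := e.nonempty_congr.mp inferInstance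
  refine (tw_mi_le (fun (m : M × N) z => twP2 Q c m.1 (e.symm m.2).1 (e.symm m.2).2 z)
    (twQP PU K Q) (fun m => tw_P2_chan hQ c _ _ _) (tw_QP_pmf hPU hK hQ)
    (fun m z => tw_P2_ac hPU hK hQ c h1 h2 _ _ _ z) κ hκ).trans (le_of_eq ?_)
  unfold twD2
  have hc : Fintype.card (M × A × B) = Fintype.card (M × N) :=
    Fintype.card_congr (Equiv.prodCongr (Equiv.refl M) e)
  rw [hκ, hc]
  congr 1
  exact Fintype.sum_equiv (Equiv.prodCongr (Equiv.refl M) e.symm) _ _ (fun x => rfl)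

/-- leakage of the first message -/
lemma tw_leak1 {U V Z M A B T S : Type*} [Fintype U] [Fintype V] [Fintype Z]
    [Fintype M] [Fintype A] [Fintype B] [Fintype T] [Fintype S]
    [Nonempty M] [Nonempty A] [Nonempty B] [Nonempty T] [Nonempty S]
    {K : U → V → ℝ} {Q : V → Z → ℝ}
    (hK : IsChannel K) (hQ : IsChannel Q)
    (c : A × T → U × (M × B × S → V))
    (h2 : ∀ i l, 0 < K (c i).1 ((c i).2 l)) (κ : ℝ)
    (hκ : κ = (Fintype.card M : ℝ)⁻¹) :
    mutInfo (fun q : M × Z => κ * ((Fintype.card (A × T) : ℝ)⁻¹ * ∑ i, twP1 Q c q.1 i q.2))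
      ≤ twD1 K Q c := by
  have hN : (0:ℝ) < Fintype.card (A × T) := by exact_mod_cast Fintype.card_pos
  set ν : ℝ := (Fintype.card (A × T) : ℝ)⁻¹ with hν
  have hν0 : 0 < ν := inv_pos.mpr hN
  have hchan : ∀ f : A × T → Z → ℝ, IsChannel f → IsPMF (fun z => ν * ∑ i, f i z) := by
    intro f hf
    refine ⟨fun z => mul_nonneg hν0.le (Finset.sum_nonneg fun i _ => (hf i).1 z), ?_⟩
    rw [← Finset.mul_sum, Finset.sum_comm]
    simp only [(hf _).2]
    rw [Finset.sum_const, Finset.card_univ, nsmul_eq_mul, mul_one, hν, inv_mul_cancel₀ hN.ne']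
  refine (tw_mi_le (fun m z => ν * ∑ i, twP1 Q c m i z)
    (fun z => ν * ∑ i, twQU K Q (c i).1 z) (fun m => hchan _ (fun i => tw_P1_chan hQ c m i))
    (hchan _ (fun i => tw_QU_chan hK hQ _)) (fun m z h => ?_) κ hκ).trans ?_
  · have h' := pos_of_mul_pos_right h hν0.le
    obtain ⟨i, _, hi⟩ := Finset.exists_lt_of_sum_lt (f := fun _ => (0:ℝ))
      (s := Finset.univ) (by simpa using h')
    refine mul_pos hν0 (lt_of_lt_of_le (tw_P1_ac hK hQ c h2 m i z hi) ?_)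
    exact Finset.single_le_sum (f := fun i => twQU K Q (c i).1 z)
      (fun i _ => tw_QU_nonneg hK hQ _ _) (Finset.mem_univ i)
  · unfold twD1
    rw [Fintype.card_prod M, Nat.cast_mul, mul_inv, ← hκ, ← hν, mul_assoc]
    have hκ0 : 0 ≤ κ := by rw [hκ]; positivity
    refine mul_le_mul_of_nonneg_left ?_ hκ0
    rw [Fintype.sum_prod_type, Finset.mul_sum]
    refine Finset.sum_le_sum fun m _ => ?_
    rw [Finset.sum_comm, Finset.mul_sum]
    refine Finset.sum_le_sum fun z _ => ?_
    rw [mul_div_mul_left _ _ hν0.ne', mul_assoc]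
    refine mul_le_mul_of_nonneg_left ?_ hν0.le
    exact tw_logsum _ _ (fun i => (tw_P1_chan hQ c m i).1 z) (fun i => tw_QU_nonneg hK hQ _ _)
      (fun i => tw_P1_ac hK hQ c h2 m i z)

lemma tw_lln {Ω : Type*} [Fintype Ω] (w : Ω → ℝ) (hw : ∑ ω, w ω = 1) (f : Ω → ℝ) (n : ℕ) :
    ∑ ω : Fin n → Ω, (∏ i, w (ω i)) * (∑ i, f (ω i) - n * ∑ a, w a * f a) ^ 2
      = n * ∑ a, w a * (f a - ∑ a, w a * f a) ^ 2 := by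
  set μ := ∑ a, w a * f a with hμ
  have h0 : ∑ a, w a * (f a - μ) = 0 := by
    simp only [mul_sub, Finset.sum_sub_distrib, ← Finset.sum_mul, hw]
    rw [← hμ]; ring
  have h1 : ∀ ω : Fin n → Ω, (∏ i, w (ω i)) * (∑ i, f (ω i) - n * μ) ^ 2 =
      ∑ i, ∑ j, (∏ i, w (ω i)) * ((f (ω i) - μ) * (f (ω j) - μ)) := by
    intro ω
    have : ∑ i, f (ω i) - n * μ = ∑ i, (f (ω i) - μ) := by
      rw [Finset.sum_sub_distrib]; simp
    rw [this, sq, Finset.sum_mul_sum, Finset.mul_sum]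
    simp only [Finset.mul_sum]
  simp only [h1]
  rw [Finset.sum_comm]
  have h2 : ∀ i : Fin n, ∑ ω : Fin n → Ω, ∑ j, (∏ i, w (ω i)) * ((f (ω i) - μ) * (f (ω j) - μ)) =
      ∑ a, w a * (f a - μ) ^ 2 := by
    intro i
    rw [Finset.sum_comm, Finset.sum_eq_single i]
    · rw [← tw_marg1 w hw i (fun a => (f a - μ) ^ 2)]
      exact Finset.sum_congr rfl fun ω _ => by ring
    · intro j _ hj
      rw [tw_marg2 w hw i j hj.symm (fun a => f a - μ) (fun a => f a - μ), h0, zero_mul]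
    · simp
  simp [h2]

def twPow {α : Type*} (n : ℕ) (p : α → ℝ) (xs : Fin n → α) : ℝ := ∏ i, p (xs i)

def twPowK {α β : Type*} (n : ℕ) (K : α → β → ℝ) (xs : Fin n → α) (ys : Fin n → β) : ℝ :=
  ∏ i, K (xs i) (ys i)

lemma twPow_pmf {α : Type*} [Fintype α] (n : ℕ) {p : α → ℝ} (hp : IsPMF p) : IsPMF (twPow n p) := by
  refine ⟨fun x => Finset.prod_nonneg fun i _ => hp.1 _, ?_⟩
  unfold twPow
  rw [tw_sum_pi (fun (_ : Fin n) a => p a)]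
  simp [hp.2]

lemma twPowK_chan {α β : Type*} [Fintype β] (n : ℕ) {K : α → β → ℝ} (hK : IsChannel K) :
    IsChannel (twPowK n K) := by
  intro xs
  refine ⟨fun x => Finset.prod_nonneg fun i _ => (hK _).1 _, ?_⟩
  unfold twPowK
  rw [tw_sum_pi (fun (i : Fin n) b => K (xs i) b)]
  simp [(hK _).2]

lemma twQU_pow {U V Z : Type*} [Fintype V] (n : ℕ) (K : U → V → ℝ) (Q : V → Z → ℝ) :
    twQU (twPowK n K) (twPowK n Q) = twPowK n (twQU K Q) := by
  funext us zs
  unfold twQU twPowK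
  simp only [← Finset.prod_mul_distrib]
  rw [tw_sum_pi (fun (i : Fin n) v => K (us i) v * Q v (zs i))]

lemma twQP_pow {U V Z : Type*} [Fintype U] [Fintype V] (n : ℕ) (PU : U → ℝ) (K : U → V → ℝ)
    (Q : V → Z → ℝ) :
    twQP (twPow n PU) (twPowK n K) (twPowK n Q) = twPow n (twQP PU K Q) := by
  funext zs
  unfold twQP
  rw [twQU_pow]
  unfold twPow twPowK
  simp only [← Finset.prod_mul_distrib]
  rw [tw_sum_pi (fun (i : Fin n) u => PU u * twQU K Q u (zs i))]

def twW {U V Z : Type*} (PU : U → ℝ) (K : U → V → ℝ) (Q : V → Z → ℝ) (ω : U × V × Z) : ℝ :=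
  PU ω.1 * K ω.1 ω.2.1 * Q ω.2.1 ω.2.2

lemma twW_pmf {U V Z : Type*} [Fintype U] [Fintype V] [Fintype Z] {PU : U → ℝ} {K : U → V → ℝ}
    {Q : V → Z → ℝ} (hPU : IsPMF PU) (hK : IsChannel K) (hQ : IsChannel Q) :
    IsPMF (twW PU K Q) := by
  refine ⟨fun ω => mul_nonneg (mul_nonneg (hPU.1 _) ((hK _).1 _)) ((hQ _).1 _), ?_⟩
  simp only [Fintype.sum_prod_type, twW, ← Finset.mul_sum, (hQ _).2, mul_one, (hK _).2, hPU.2]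

def twFV {U V Z : Type*} [Fintype U] [Fintype V] (PU : U → ℝ) (K : U → V → ℝ) (Q : V → Z → ℝ)
    (ω : U × V × Z) : ℝ := Real.logb 2 (Q ω.2.1 ω.2.2 / twQP PU K Q ω.2.2)
def twFU {U V Z : Type*} [Fintype U] [Fintype V] (PU : U → ℝ) (K : U → V → ℝ) (Q : V → Z → ℝ)
    (ω : U × V × Z) : ℝ := Real.logb 2 (twQU K Q ω.1 ω.2.2 / twQP PU K Q ω.2.2)
def twFC {U V Z : Type*} [Fintype V] (K : U → V → ℝ) (Q : V → Z → ℝ)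
    (ω : U × V × Z) : ℝ := Real.logb 2 (Q ω.2.1 ω.2.2 / twQU K Q ω.1 ω.2.2)

def twIV {U V Z : Type*} [Fintype U] [Fintype V] [Fintype Z] (PU : U → ℝ) (K : U → V → ℝ)
    (Q : V → Z → ℝ) : ℝ := ∑ ω, twW PU K Q ω * twFV PU K Q ω
def twIU {U V Z : Type*} [Fintype U] [Fintype V] [Fintype Z] (PU : U → ℝ) (K : U → V → ℝ)
    (Q : V → Z → ℝ) : ℝ := ∑ ω, twW PU K Q ω * twFU PU K Q ω
def twIC {U V Z : Type*} [Fintype U] [Fintype V] [Fintype Z] (PU : U → ℝ) (K : U → V → ℝ)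
    (Q : V → Z → ℝ) : ℝ := ∑ ω, twW PU K Q ω * twFC K Q ω

def twVar {Ω : Type*} [Fintype Ω] (w f : Ω → ℝ) : ℝ := ∑ a, w a * (f a - ∑ a, w a * f a) ^ 2

lemma tw_triple {U V Z : Type*} [Fintype U] [Fintype V] [Fintype Z] (n : ℕ) (PU : U → ℝ)
    (K : U → V → ℝ) (Q : V → Z → ℝ) (H : (Fin n → U) → (Fin n → V) → (Fin n → Z) → ℝ) :
    ∑ us, ∑ vs, ∑ zs, twPow n PU us * twPowK n K us vs * twPowK n Q vs zs * H us vs zs =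
    ∑ ω : Fin n → U × V × Z, (∏ i, twW PU K Q (ω i)) *
      H (fun i => (ω i).1) (fun i => (ω i).2.1) (fun i => (ω i).2.2) := by
  simp only [← Fintype.sum_prod_type']
  refine (Fintype.sum_equiv ((Equiv.arrowProdEquivProdArrow (Fin n) (fun _ => U) (fun _ => V × Z)).trans
    (Equiv.prodCongr (Equiv.refl _) (Equiv.arrowProdEquivProdArrow (Fin n) (fun _ => V) (fun _ => Z)))) _ _ fun ω => ?_).symm
  simp [twPow, twPowK, twW, Finset.prod_mul_distrib, Equiv.arrowProdEquivProdArrow]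

lemma tw_prod_rpow {n : ℕ} (a b : Fin n → ℝ) (ha : ∀ i, 0 < a i) (hb : ∀ i, 0 < b i) :
    ∏ i, a i = (2:ℝ) ^ (∑ i, Real.logb 2 (a i / b i)) * ∏ i, b i := by
  rw [Real.rpow_sum_of_pos (by norm_num), ← Finset.prod_mul_distrib]
  refine Finset.prod_congr rfl fun i _ => ?_
  rw [Real.rpow_logb (by norm_num) (by norm_num) (div_pos (ha i) (hb i)),
    div_mul_cancel₀ _ (hb i).ne']

lemma tw_supp {U V Z : Type*} [Fintype U] [Fintype V] [Fintype Z] {n : ℕ} {PU : U → ℝ}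
    {K : U → V → ℝ} {Q : V → Z → ℝ} (hPU : IsPMF PU) (hK : IsChannel K) (hQ : IsChannel Q)
    (ω : Fin n → U × V × Z) (h : ∏ i, twW PU K Q (ω i) ≠ 0) (i : Fin n) :
    0 < Q (ω i).2.1 (ω i).2.2 ∧ 0 < twQU K Q (ω i).1 (ω i).2.2 ∧ 0 < twQP PU K Q (ω i).2.2 := by
  have h1 := Finset.prod_ne_zero_iff.mp h i (Finset.mem_univ i)
  unfold twW at h1
  have hq := lt_of_le_of_ne ((hQ _).1 _) (Ne.symm (right_ne_zero_of_mul h1))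
  have h2 := left_ne_zero_of_mul h1
  have hk := lt_of_le_of_ne ((hK _).1 _) (Ne.symm (right_ne_zero_of_mul h2))
  have hp := lt_of_le_of_ne (hPU.1 _) (Ne.symm (left_ne_zero_of_mul h2))
  have hu := tw_QU_pos hK hQ hk hq
  exact ⟨hq, hu, tw_QP_pos hPU hK hQ hp hu⟩

open Classical in
lemma tw_bad {U V Y : Type*} [Fintype U] [Fintype V] [Fintype Y] {PU : U → ℝ}
    {K : U → V → ℝ} {Q : V → Y → ℝ} (hPU : IsPMF PU) (hK : IsChannel K) (hQ : IsChannel Q)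
    (n : ℕ) (hn : 0 < n) (δ : ℝ) (hδ : 0 < δ) :
    ∑ u, ∑ v, ∑ y, twPow n PU u * twPowK n K u v * twPowK n Q v y *
          (if (2:ℝ) ^ (n * (twIC PU K Q - δ)) * twQU (twPowK n K) (twPowK n Q) u y < twPowK n Q v y ∧
            (2:ℝ) ^ (n * (twIV PU K Q - δ)) * twQP (twPow n PU) (twPowK n K) (twPowK n Q) y
              < twPowK n Q v y then 0 else 1)
      ≤ (twVar (twW PU K Q) (twFC K Q) + twVar (twW PU K Q) (twFV PU K Q)) / (n * δ ^ 2) := by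
  have hn' : (0:ℝ) < n := by exact_mod_cast hn
  rw [tw_triple n PU K Q, twQU_pow, twQP_pow]
  have hw := twW_pmf hPU hK hQ
  have l1 := tw_lln (twW PU K Q) hw.2 (twFC K Q) n
  have l2 := tw_lln (twW PU K Q) hw.2 (twFV PU K Q) n
  change _ = n * twVar _ _ at l1
  change _ = n * twVar _ _ at l2
  change ∑ ω : Fin n → U × V × Y, _ * (_ - n * twIC PU K Q) ^ 2 = _ at l1
  change ∑ ω : Fin n → U × V × Y, _ * (_ - n * twIV PU K Q) ^ 2 = _ at l2
  have e : (twVar (twW PU K Q) (twFC K Q) + twVar (twW PU K Q) (twFV PU K Q)) / (n * δ ^ 2) =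
      (n * twVar (twW PU K Q) (twFC K Q) + n * twVar (twW PU K Q) (twFV PU K Q)) / (n * δ) ^ 2 := by
    field_simp
  rw [e, ← l1, ← l2, ← Finset.sum_add_distrib, Finset.sum_div]
  refine Finset.sum_le_sum fun ω _ => ?_
  by_cases h : ∏ i, twW PU K Q (ω i) = 0
  · simp [h]
  have hs := tw_supp hPU hK hQ ω h
  have hw0 : 0 ≤ ∏ i, twW PU K Q (ω i) := Finset.prod_nonneg fun i _ => hw.1 _
  rw [← mul_add, mul_div_assoc]
  refine mul_le_mul_of_nonneg_left ?_ hw0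
  have p1 := tw_prod_rpow (fun i => Q (ω i).2.1 (ω i).2.2) (fun i => twQU K Q (ω i).1 (ω i).2.2)
    (fun i => (hs i).1) (fun i => (hs i).2.1)
  have p2 := tw_prod_rpow (fun i => Q (ω i).2.1 (ω i).2.2) (fun i => twQP PU K Q (ω i).2.2)
    (fun i => (hs i).1) (fun i => (hs i).2.2)
  change _ = 2 ^ (∑ i, twFC K Q (ω i)) * _ at p1
  change _ = 2 ^ (∑ i, twFV PU K Q (ω i)) * _ at p2
  have q1 : 0 < ∏ i, twQU K Q (ω i).1 (ω i).2.2 := Finset.prod_pos fun i _ => (hs i).2.1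
  have q2 : 0 < ∏ i, twQP PU K Q (ω i).2.2 := Finset.prod_pos fun i _ => (hs i).2.2
  split_ifs with hc
  · positivity
  · rw [le_div_iff₀ (by positivity), one_mul]
    have aux : ∀ X I : ℝ, X ≤ n * (I - δ) → (n * δ) ^ 2 ≤ (X - n * I) ^ 2 := by
      intro X I hX
      have : n * δ ≤ n * I - X := by linarith
      have h3 : 0 ≤ n * δ := by positivity
      nlinarith
    rw [not_and_or, not_lt, not_lt] at hc
    rcases hc with hc | hc
    · unfold twPowK at hc
      rw [p1] at hc
      have := (Real.rpow_le_rpow_left_iff (by norm_num : (1:ℝ) < 2)).mp (le_of_mul_le_mul_right hc q1)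
      have := aux _ _ this
      nlinarith [sq_nonneg (∑ i, twFV PU K Q (ω i) - n * twIV PU K Q)]
    · unfold twPowK twPow at hc
      rw [p2] at hc
      have := (Real.rpow_le_rpow_left_iff (by norm_num : (1:ℝ) < 2)).mp (le_of_mul_le_mul_right hc q2)
      have := aux _ _ this
      nlinarith [sq_nonneg (∑ i, twFC K Q (ω i) - n * twIC PU K Q)]

lemma tw_abs_le (x t : ℝ) (ht : 0 < t) : |x| ≤ t + x ^ 2 / t := by
  rw [← sub_le_iff_le_add', le_div_iff₀ ht, ← sq_abs x]
  nlinarith [sq_nonneg (|x| - t), abs_nonneg x]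

lemma tw_lg_bound (x y : ℝ) (a b : ℝ) (ha0 : 0 ≤ a) (hb0 : 0 ≤ b) (ha : a ≤ (2:ℝ) ^ x)
    (hb : b ≤ (2:ℝ) ^ y) : Real.logb 2 (1 + a + b) ≤ 2 + |x| + |y| := by
  rw [Real.logb_le_iff_le_rpow (by norm_num) (by positivity)]
  have h0 : (1:ℝ) ≤ 2 ^ (|x| + |y|) := Real.one_le_rpow (by norm_num) (by positivity)
  have h1 : (2:ℝ) ^ x ≤ 2 ^ (|x| + |y|) := Real.rpow_le_rpow_of_exponent_le (by norm_num)
    (by linarith [le_abs_self x, abs_nonneg y])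
  have h2 : (2:ℝ) ^ y ≤ 2 ^ (|x| + |y|) := Real.rpow_le_rpow_of_exponent_le (by norm_num)
    (by linarith [le_abs_self y, abs_nonneg x])
  have h3 : (2:ℝ) ^ (2:ℝ) = 4 := by norm_num
  rw [add_assoc (2:ℝ) |x| |y|, Real.rpow_add (by norm_num), h3]
  linarith

lemma tw_b2 {U V Z : Type*} [Fintype U] [Fintype V] [Fintype Z] {PU : U → ℝ}
    {K : U → V → ℝ} {Q : V → Z → ℝ} (hPU : IsPMF PU) (hK : IsChannel K) (hQ : IsChannel Q)
    (n : ℕ) (hn : 0 < n) (η : ℝ) (hη : 0 < η) (T S : ℝ) (hT : 0 < T) (hS : 0 < S)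
    (hTI : (2:ℝ) ^ (n * twIU PU K Q) ≤ T) (hTS : (2:ℝ) ^ (n * twIV PU K Q) ≤ T * S) :
    ∑ u, ∑ v, ∑ z, twPow n PU u * twPowK n K u v * twPowK n Q v z *
      Real.logb 2 (1 + (twQP (twPow n PU) (twPowK n K) (twPowK n Q) z)⁻¹ *
        T⁻¹ * (S⁻¹ * twPowK n Q v z + twQU (twPowK n K) (twPowK n Q) u z))
    ≤ 2 + 2 * (n * η) + (twVar (twW PU K Q) (twFV PU K Q) + twVar (twW PU K Q) (twFU PU K Q)) / η := by
  have hn' : (0:ℝ) < n := by exact_mod_cast hn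
  rw [tw_triple n PU K Q, twQU_pow, twQP_pow]
  have hw := twW_pmf hPU hK hQ
  have l1 := tw_lln (twW PU K Q) hw.2 (twFU PU K Q) n
  have l2 := tw_lln (twW PU K Q) hw.2 (twFV PU K Q) n
  change _ = n * twVar _ _ at l1
  change _ = n * twVar _ _ at l2
  change ∑ ω : Fin n → U × V × Z, _ * (_ - n * twIU PU K Q) ^ 2 = _ at l1
  change ∑ ω : Fin n → U × V × Z, _ * (_ - n * twIV PU K Q) ^ 2 = _ at l2
  have hw1 : ∑ ω : Fin n → U × V × Z, ∏ i, twW PU K Q (ω i) = 1 := (twPow_pmf n hw).2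
  calc _ ≤ ∑ ω : Fin n → U × V × Z, (∏ i, twW PU K Q (ω i)) * ((2 + 2 * (n * η)) +
        ((∑ i, twFV PU K Q (ω i) - n * twIV PU K Q) ^ 2
          + (∑ i, twFU PU K Q (ω i) - n * twIU PU K Q) ^ 2) / (n * η)) := by
        refine Finset.sum_le_sum fun ω _ => ?_
        by_cases h : ∏ i, twW PU K Q (ω i) = 0
        · simp [h]
        have hs := tw_supp hPU hK hQ ω h
        have hw0 : 0 ≤ ∏ i, twW PU K Q (ω i) := Finset.prod_nonneg fun i _ => hw.1 _
        refine mul_le_mul_of_nonneg_left ?_ hw0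
        have p1 := tw_prod_rpow (fun i => twQU K Q (ω i).1 (ω i).2.2) (fun i => twQP PU K Q (ω i).2.2)
          (fun i => (hs i).2.1) (fun i => (hs i).2.2)
        have p2 := tw_prod_rpow (fun i => Q (ω i).2.1 (ω i).2.2) (fun i => twQP PU K Q (ω i).2.2)
          (fun i => (hs i).1) (fun i => (hs i).2.2)
        change _ = 2 ^ (∑ i, twFU PU K Q (ω i)) * _ at p1
        change _ = 2 ^ (∑ i, twFV PU K Q (ω i)) * _ at p2
        have q2 : 0 < ∏ i, twQP PU K Q (ω i).2.2 := Finset.prod_pos fun i _ => (hs i).2.2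
        unfold twPowK twPow
        rw [p1, p2]
        set R := ∏ i, twQP PU K Q (ω i).2.2
        set XV := ∑ i, twFV PU K Q (ω i)
        set XU := ∑ i, twFU PU K Q (ω i)
        have e : 1 + R⁻¹ * T⁻¹ * (S⁻¹ * ((2:ℝ) ^ XV * R) + 2 ^ XU * R) =
          1 + (2:ℝ) ^ XV / (T * S) + 2 ^ XU / T := by field_simp; ring
        rw [e]
        have b := tw_lg_bound (XV - n * twIV PU K Q) (XU - n * twIU PU K Q) ((2:ℝ) ^ XV / (T * S))
          (2 ^ XU / T) (by positivity) (by positivity)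
          (by rw [Real.rpow_sub (by norm_num)]; gcongr) (by rw [Real.rpow_sub (by norm_num)]; gcongr)
        have a1 := tw_abs_le (XV - n * twIV PU K Q) (n * η) (by positivity)
        have a2 := tw_abs_le (XU - n * twIU PU K Q) (n * η) (by positivity)
        rw [add_div]
        linarith
    _ = _ := by
        simp only [mul_add (∏ i, twW PU K Q _), Finset.sum_add_distrib, ← Finset.sum_mul, hw1,
          ← mul_div_assoc, ← Finset.sum_div, l1, l2]
        field_simp

lemma tw_b1 {U V Z : Type*} [Fintype U] [Fintype V] [Fintype Z] {PU : U → ℝ}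
    {K : U → V → ℝ} {Q : V → Z → ℝ} (hPU : IsPMF PU) (hK : IsChannel K) (hQ : IsChannel Q)
    (n : ℕ) (hn : 0 < n) (η : ℝ) (hη : 0 < η) (S : ℝ) (hS : 0 < S)
    (hTS : (2:ℝ) ^ (n * twIC PU K Q) ≤ S) :
    ∑ u, ∑ v, ∑ z, twPow n PU u * twPowK n K u v * twPowK n Q v z *
      Real.logb 2 ((twQU (twPowK n K) (twPowK n Q) u z)⁻¹ *
        (S⁻¹ * twPowK n Q v z + twQU (twPowK n K) (twPowK n Q) u z))
    ≤ 2 + n * η + twVar (twW PU K Q) (twFC K Q) / η := by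
  have hn' : (0:ℝ) < n := by exact_mod_cast hn
  rw [tw_triple n PU K Q, twQU_pow]
  have hw := twW_pmf hPU hK hQ
  have l1 := tw_lln (twW PU K Q) hw.2 (twFC K Q) n
  change _ = n * twVar _ _ at l1
  change ∑ ω : Fin n → U × V × Z, _ * (_ - n * twIC PU K Q) ^ 2 = _ at l1
  have hw1 : ∑ ω : Fin n → U × V × Z, ∏ i, twW PU K Q (ω i) = 1 := (twPow_pmf n hw).2
  calc _ ≤ ∑ ω : Fin n → U × V × Z, (∏ i, twW PU K Q (ω i)) * ((2 + (n * η)) +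
        ((∑ i, twFC K Q (ω i) - n * twIC PU K Q) ^ 2) / (n * η)) := by
        refine Finset.sum_le_sum fun ω _ => ?_
        by_cases h : ∏ i, twW PU K Q (ω i) = 0
        · simp [h]
        have hs := tw_supp hPU hK hQ ω h
        have hw0 : 0 ≤ ∏ i, twW PU K Q (ω i) := Finset.prod_nonneg fun i _ => hw.1 _
        refine mul_le_mul_of_nonneg_left ?_ hw0
        have p2 := tw_prod_rpow (fun i => Q (ω i).2.1 (ω i).2.2) (fun i => twQU K Q (ω i).1 (ω i).2.2)
          (fun i => (hs i).1) (fun i => (hs i).2.1)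
        change _ = 2 ^ (∑ i, twFC K Q (ω i)) * _ at p2
        have q2 : 0 < ∏ i, twQU K Q (ω i).1 (ω i).2.2 := Finset.prod_pos fun i _ => (hs i).2.1
        unfold twPowK
        rw [p2]
        set R := ∏ i, twQU K Q (ω i).1 (ω i).2.2
        set XV := ∑ i, twFC K Q (ω i)
        have e : R⁻¹ * (S⁻¹ * ((2:ℝ) ^ XV * R) + R) =
          1 + (2:ℝ) ^ XV / S + 0 := by field_simp; ring
        rw [e]
        have b := tw_lg_bound (XV - n * twIC PU K Q) 0 ((2:ℝ) ^ XV / S)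
          0 (by positivity) le_rfl
          (by rw [Real.rpow_sub (by norm_num)]; gcongr) (by norm_num)
        have a1 := tw_abs_le (XV - n * twIC PU K Q) (n * η) (by positivity)
        rw [abs_zero] at b
        linarith
    _ = _ := by
        simp only [mul_add (∏ i, twW PU K Q _), Finset.sum_add_distrib, ← Finset.sum_mul, hw1,
          ← mul_div_assoc, ← Finset.sum_div, l1]
        field_simp

lemma tw_P2_marg {U V X Z M A B T S : Type*} [Fintype X] [Fintype T] [Fintype S] (n : ℕ)
    (P : V → X → ℝ) (Q : X → Z → ℝ)
    (c : A × T → U × (M × B × S → (Fin n → V))) (m : M) (a : A) (b : B) (z : Fin n → Z) :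
    ∑ xs, twP2 (twPowK n P) c m a b xs * twPowK n Q xs z =
      twP2 (twPowK n (twQU P Q)) c m a b z := by
  unfold twP2
  rw [← twQU_pow]
  unfold twQU
  simp only [Finset.mul_sum, Finset.sum_mul]
  rw [Finset.sum_comm]
  refine Finset.sum_congr rfl fun t _ => ?_
  rw [Finset.sum_comm]
  refine Finset.sum_congr rfl fun s _ => Finset.sum_congr rfl fun x _ => ?_
  ring

lemma tw_prodY {X Y Z₁ Z₂ : Type} [Fintype X] [Fintype Y] [Fintype Z₁] [Fintype Z₂] (n : ℕ)
    (W : X → Y × Z₁ × Z₂ → ℝ) (xs : Fin n → X) (ys : Fin n → Y) :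
    ∑ z1s : Fin n → Z₁, ∑ z2s : Fin n → Z₂, ∏ i, W (xs i) (ys i, z1s i, z2s i) =
      twPowK n (WY W) xs ys := by
  unfold twPowK WY
  have h := fun z1s : Fin n → Z₁ => tw_sum_pi (fun (i : Fin n) z => W (xs i) (ys i, z1s i, z))
  simp only [h]
  rw [tw_sum_pi (fun (i : Fin n) z => ∑ z₂, W (xs i) (ys i, z, z₂))]

lemma tw_prodZ1 {X Y Z₁ Z₂ : Type} [Fintype X] [Fintype Y] [Fintype Z₁] [Fintype Z₂] (n : ℕ)
    (W : X → Y × Z₁ × Z₂ → ℝ) (xs : Fin n → X) (z1s : Fin n → Z₁) :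
    ∑ ys : Fin n → Y, ∑ z2s : Fin n → Z₂, ∏ i, W (xs i) (ys i, z1s i, z2s i) =
      twPowK n (WZ1 W) xs z1s := by
  unfold twPowK WZ1
  have h := fun ys : Fin n → Y => tw_sum_pi (fun (i : Fin n) z => W (xs i) (ys i, z1s i, z))
  simp only [h]
  rw [tw_sum_pi (fun (i : Fin n) y => ∑ z₂, W (xs i) (y, z1s i, z₂))]

lemma tw_prodZ2 {X Y Z₁ Z₂ : Type} [Fintype X] [Fintype Y] [Fintype Z₁] [Fintype Z₂] (n : ℕ)
    (W : X → Y × Z₁ × Z₂ → ℝ) (xs : Fin n → X) (z2s : Fin n → Z₂) :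
    ∑ ys : Fin n → Y, ∑ z1s : Fin n → Z₁, ∏ i, W (xs i) (ys i, z1s i, z2s i) =
      twPowK n (WZ2 W) xs z2s := by
  unfold twPowK WZ2
  have h := fun ys : Fin n → Y => tw_sum_pi (fun (i : Fin n) z => W (xs i) (ys i, z, z2s i))
  simp only [h]
  rw [tw_sum_pi (fun (i : Fin n) y => ∑ z₁, W (xs i) (y, z₁, z2s i))]

/-- the superposition encoder -/
def twEnc {U V X : Type*} {n K₁ Ka Kb Kt Ks : ℕ} (P : V → X → ℝ)
    (c : Fin Ka × Fin Kt → U × (Fin K₁ × Fin Kb × Fin Ks → (Fin n → V)))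
    (m : Fin K₁ × Fin (Ka * Kb)) (xs : Fin n → X) : ℝ :=
  twP2 (twPowK n P) c m.1 (finProdFinEquiv.symm m.2).1 (finProdFinEquiv.symm m.2).2 xs

def twDec {Y : Type*} {K₁ Ka Kb Kt Ks : ℕ}
    (d : Y → (Fin Ka × Fin Kt) × (Fin K₁ × Fin Kb × Fin Ks)) (y : Y) :
    Fin K₁ × Fin (Ka * Kb) :=
  ((d y).2.1, finProdFinEquiv ((d y).1.1, (d y).2.2.1))

section bridge
variable {U V X Y Z₁ Z₂ : Type} [Fintype U] [Fintype V] [Fintype X] [Fintype Y] [Fintype Z₁]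
  [Fintype Z₂] {n K₁ Ka Kb Kt Ks : ℕ}

lemma tw_leak2_bridge (W : X → Y × Z₁ × Z₂ → ℝ) {U V : Type} [Fintype U] [Fintype V]
    [NeZero K₁] [NeZero Ka] [NeZero Kb] [NeZero Kt] [NeZero Ks]
    {PU : U → ℝ} {K : U → V → ℝ} {P : V → X → ℝ} (hPU : IsPMF PU) (hK : IsChannel K)
    (hQ : IsChannel (twQU P (WZ2 W)))
    (c : Fin Ka × Fin Kt → (Fin n → U) × (Fin K₁ × Fin Kb × Fin Ks → (Fin n → V)))
    (h1 : ∀ i, 0 < twPow n PU (c i).1) (h2 : ∀ i l, 0 < twPowK n K (c i).1 ((c i).2 l)) :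
    leakMZ2 W (twEnc P c) ≤
      twD2 (twPow n PU) (twPowK n K) (twPowK n (twQU P (WZ2 W))) c := by
  have h := tw_leak2 (twPow_pmf n hPU) (twPowK_chan n hK) (twPowK_chan n hQ) c h1 h2
    finProdFinEquiv (((K₁ : ℝ) * ((Ka * Kb : ℕ) : ℝ))⁻¹) (by simp)
  refine le_trans (le_of_eq ?_) h
  unfold leakMZ2
  congr 1
  funext q
  unfold codeJoint twEnc
  simp only [← Finset.mul_sum, tw_prodZ2, mul_assoc]
  rw [tw_P2_marg]

lemma tw_leak1_marg (W : X → Y × Z₁ × Z₂ → ℝ) {U V : Type}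
    {P : V → X → ℝ}
    (c : Fin Ka × Fin Kt → (Fin n → U) × (Fin K₁ × Fin Kb × Fin Ks → (Fin n → V)))
    (m : Fin K₁) (z : Fin n → Z₁) :
    ∑ m₂, ∑ xs, ∑ ys, ∑ z2s, codeJoint W (twEnc P c) (m, m₂) xs ys z z2s =
      (K₁ : ℝ)⁻¹ * ((Fintype.card (Fin Ka × Fin Kt) : ℝ)⁻¹ *
        ∑ i, twP1 (twPowK n (twQU P (WZ1 W))) c m i z) := by
  unfold codeJoint twEnc
  simp only [← Finset.mul_sum, tw_prodZ1, mul_assoc, tw_P2_marg]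
  rw [← Fintype.sum_equiv finProdFinEquiv
    (fun x : Fin Ka × Fin Kb => twP2 (twPowK n (twQU P (WZ1 W))) c m x.1 x.2 z) _ (fun x => by simp)]
  unfold twP2 twP1
  simp only [Fintype.sum_prod_type, ← Finset.mul_sum, Fintype.card_prod, Fintype.card_fin]
  simp only [Finset.sum_comm (s := (Finset.univ : Finset (Fin Kb))) (t := (Finset.univ : Finset (Fin Kt)))]
  push_cast
  simp only [mul_inv]
  ring

lemma tw_leak1_bridge (W : X → Y × Z₁ × Z₂ → ℝ) {U V : Type} [Fintype U] [Fintype V]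
    [NeZero K₁] [NeZero Ka] [NeZero Kb] [NeZero Kt] [NeZero Ks]
    {K : U → V → ℝ} {P : V → X → ℝ} (hK : IsChannel K)
    (hQ : IsChannel (twQU P (WZ1 W)))
    (c : Fin Ka × Fin Kt → (Fin n → U) × (Fin K₁ × Fin Kb × Fin Ks → (Fin n → V)))
    (h2 : ∀ i l, 0 < twPowK n K (c i).1 ((c i).2 l)) :
    leakM1Z1 W (twEnc P c) ≤
      twD1 (twPowK n K) (twPowK n (twQU P (WZ1 W))) c := by
  have h := tw_leak1 (twPowK_chan n hK) (twPowK_chan n hQ) c h2 ((K₁ : ℝ)⁻¹) (by simp)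
  refine le_trans (le_of_eq ?_) h
  unfold leakM1Z1
  congr 1
  funext q
  exact tw_leak1_marg W c q.1 q.2

lemma tw_err_bridge (W : X → Y × Z₁ × Z₂ → ℝ) {U V : Type} [Fintype U] [Fintype V]
    {P : V → X → ℝ} (hQ : IsChannel (twQU P (WY W)))
    (c : Fin Ka × Fin Kt → (Fin n → U) × (Fin K₁ × Fin Kb × Fin Ks → (Fin n → V)))
    (d : (Fin n → Y) → (Fin Ka × Fin Kt) × (Fin K₁ × Fin Kb × Fin Ks)) :
    errProb W (twEnc P c) (twDec d) ≤ twErr (twPowK n (twQU P (WY W))) c d := by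
  classical
  have hm : ∀ m : Fin K₁ × Fin (Ka * Kb), ∑ xs, ∑ ys, ∑ z1s, ∑ z2s,
      (if twDec d ys ≠ m then codeJoint W (twEnc P c) m xs ys z1s z2s else 0) =
      ((K₁ : ℝ) * ((Ka * Kb : ℕ) : ℝ))⁻¹ * ∑ ys, (if twDec d ys ≠ m then 1 else 0) *
        twP2 (twPowK n (twQU P (WY W))) c m.1 (finProdFinEquiv.symm m.2).1
          (finProdFinEquiv.symm m.2).2 ys := by
    intro m
    rw [Finset.sum_comm, Finset.mul_sum]
    refine Finset.sum_congr rfl fun ys _ => ?_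
    by_cases hd : twDec d ys ≠ m
    · simp only [if_pos hd, one_mul]
      unfold codeJoint twEnc
      simp only [← Finset.mul_sum, tw_prodY, mul_assoc, tw_P2_marg]
    · simp only [if_neg hd]
      simp
  have hlow : ((Fintype.card ((Fin Ka × Fin Kt) × (Fin K₁ × Fin Kb × Fin Ks)) : ℝ))⁻¹ *
      ∑ x : (Fin Ka × Fin Kt) × (Fin K₁ × Fin Kb × Fin Ks), ∑ y,
        twPowK n (twQU P (WY W)) ((c x.1).2 x.2) y *
        (if twDec d y ≠ (x.2.1, finProdFinEquiv (x.1.1, x.2.2.1)) then 1 else 0) ≤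
      twErr (twPowK n (twQU P (WY W))) c d := by
    unfold twErr
    refine mul_le_mul_of_nonneg_left (Finset.sum_le_sum fun x _ => Finset.sum_le_sum fun y _ =>
      mul_le_mul_of_nonneg_left ?_ ((twPowK_chan n hQ _).1 _)) (by positivity)
    by_cases hd : d y = x
    · have : twDec d y = (x.2.1, finProdFinEquiv (x.1.1, x.2.2.1)) := by unfold twDec; rw [hd]
      simp [this, hd]
    · rw [if_pos hd]; split_ifs <;> norm_num
  refine le_trans (le_of_eq ?_) hlow
  unfold errProb
  simp only [hm]
  rw [← Finset.mul_sum, Fintype.sum_prod_type]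
  have hre : ∀ m₁ : Fin K₁, ∑ m₂ : Fin (Ka * Kb), ∑ ys, (if twDec d ys ≠ (m₁, m₂) then (1:ℝ) else 0) *
        twP2 (twPowK n (twQU P (WY W))) c m₁ (finProdFinEquiv.symm m₂).1
          (finProdFinEquiv.symm m₂).2 ys = ∑ a, ∑ b, ∑ ys,
          (if twDec d ys ≠ (m₁, finProdFinEquiv (a, b)) then (1:ℝ) else 0) *
        twP2 (twPowK n (twQU P (WY W))) c m₁ a b ys := by
    intro m₁
    refine Eq.trans ?_ (Fintype.sum_prod_type' (fun (a : Fin Ka) (b : Fin Kb) => ∑ ys,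
          (if twDec d ys ≠ (m₁, finProdFinEquiv (a, b)) then (1:ℝ) else 0) *
        twP2 (twPowK n (twQU P (WY W))) c m₁ a b ys))
    exact (Fintype.sum_equiv finProdFinEquiv _ _ (fun x => by simp)).symm
  simp only [hre]
  have hx : ∀ (m₁ : Fin K₁) (a : Fin Ka) (b : Fin Kb), ∑ ys,
          (if twDec d ys ≠ (m₁, finProdFinEquiv (a, b)) then (1:ℝ) else 0) *
        twP2 (twPowK n (twQU P (WY W))) c m₁ a b ys = ((Kt:ℝ) * Ks)⁻¹ * ∑ t, ∑ s, ∑ ys,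
        twPowK n (twQU P (WY W)) ((c (a, t)).2 (m₁, b, s)) ys *
        (if twDec d ys ≠ (m₁, finProdFinEquiv (a, b)) then 1 else 0) := by
    intro m₁ a b
    unfold twP2
    simp only [Finset.mul_sum, Fintype.card_fin]
    rw [Finset.sum_comm]
    refine Finset.sum_congr rfl fun t _ => ?_
    rw [Finset.sum_comm]
    refine Finset.sum_congr rfl fun s _ => ?_
    refine Finset.sum_congr rfl fun y _ => ?_
    rw [mul_inv]
    ring
  simp only [hx, ← Finset.mul_sum, Fintype.sum_prod_type, Fintype.card_prod, Fintype.card_fin]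
  rw [← mul_assoc]
  congr 1
  · push_cast
    simp only [mul_inv]
    ring
  · rw [Finset.sum_comm]
    refine Finset.sum_congr rfl fun a _ => ?_
    rw [Finset.sum_comm (s := (Finset.univ : Finset (Fin Kt)))]
    refine Finset.sum_congr rfl fun m _ => ?_
    rw [Finset.sum_comm]

end bridge

/-- size of a message set of rate `r` -/
def twN (n : ℕ) (r : ℝ) : ℕ := ⌈(2:ℝ) ^ (n * r)⌉₊

lemma twN_lo (n : ℕ) (r : ℝ) : (2:ℝ) ^ (n * r) ≤ twN n r := Nat.le_ceil _

lemma twN_hi (n : ℕ) (r : ℝ) (hr : 0 ≤ r) : (twN n r : ℝ) ≤ 2 * (2:ℝ) ^ (n * r) := by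
  have h := (Nat.ceil_lt_add_one (show (0:ℝ) ≤ (2:ℝ) ^ (n * r) by positivity)).le
  have h1 : (1:ℝ) ≤ (2:ℝ) ^ (n * r) := Real.one_le_rpow (by norm_num) (by positivity)
  unfold twN
  linarith

lemma twN_pos (n : ℕ) (r : ℝ) : 0 < twN n r := Nat.ceil_pos.mpr (by positivity)

lemma twN_zero (n : ℕ) : twN n 0 = 1 := by simp [twN]

lemma twN_log (n : ℕ) (r : ℝ) : n * r ≤ Real.logb 2 (twN n r) := by
  rw [Real.le_logb_iff_rpow_le (by norm_num) (by exact_mod_cast twN_pos n r)]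
  exact twN_lo n r

lemma tw_var_nonneg {Ω : Type*} [Fintype Ω] {w : Ω → ℝ} (hw : IsPMF w) (f : Ω → ℝ) :
    0 ≤ twVar w f := Finset.sum_nonneg fun a _ => mul_nonneg (hw.1 a) (sq_nonneg _)

lemma tw_large (C δ ε : ℝ) (hδ : 0 < δ) (hε : 0 < ε) :
    ∃ n : ℕ, 0 < n ∧ C / n + 40 * (2:ℝ) ^ (-(n * δ)) ≤ ε := by
  have h1 : Filter.Tendsto (fun n : ℕ => C / (n:ℝ)) Filter.atTop (nhds 0) :=
    tendsto_const_div_atTop_nhds_zero_nat C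
  have h2 : Filter.Tendsto (fun n : ℕ => ((2:ℝ) ^ (-δ)) ^ n) Filter.atTop (nhds 0) :=
    tendsto_pow_atTop_nhds_zero_of_lt_one (by positivity)
      (Real.rpow_lt_one_of_one_lt_of_neg (by norm_num) (by linarith))
  have h3 := h1.add (h2.const_mul 40)
  simp only [mul_zero, add_zero] at h3
  have h4 := (h3.eventually (gt_mem_nhds hε)).and (Filter.eventually_gt_atTop 0)
  obtain ⟨n, hn, hn0⟩ := h4.exists
  refine ⟨n, hn0, ?_⟩
  have : (2:ℝ) ^ (-(n * δ)) = ((2:ℝ) ^ (-δ)) ^ n := by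
    rw [← Real.rpow_natCast, ← Real.rpow_mul (by norm_num)]
    congr 1
    ring
  rw [this]
  exact hn.le

lemma tw_mutInfo_subsing {α β : Type*} [Fintype α] [Fintype β] [Subsingleton α] (p : α × β → ℝ)
    (h : ∀ a, ∑ b, p (a, b) = 1) : mutInfo p = 0 := by
  refine Finset.sum_eq_zero fun x _ => ?_
  obtain ⟨a, b⟩ := x
  simp only [h, one_mul]
  rw [Fintype.sum_eq_single a (fun x hx => absurd (Subsingleton.elim x a) hx)]
  by_cases h0 : p (a, b) = 0
  · simp [h0]
  · simp [div_self h0]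

lemma tw_WY_chan {X Y Z₁ Z₂ : Type} [Fintype X] [Fintype Y] [Fintype Z₁] [Fintype Z₂]
    {W : X → Y × Z₁ × Z₂ → ℝ} (hW : IsChannel W) : IsChannel (WY W) := by
  refine fun x => ⟨fun y => Finset.sum_nonneg fun _ _ => Finset.sum_nonneg fun _ _ => (hW x).1 _, ?_⟩
  rw [← (hW x).2]
  simp only [Fintype.sum_prod_type, WY]

lemma tw_WZ1_chan {X Y Z₁ Z₂ : Type} [Fintype X] [Fintype Y] [Fintype Z₁] [Fintype Z₂]
    {W : X → Y × Z₁ × Z₂ → ℝ} (hW : IsChannel W) : IsChannel (WZ1 W) := by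
  refine fun x => ⟨fun y => Finset.sum_nonneg fun _ _ => Finset.sum_nonneg fun _ _ => (hW x).1 _, ?_⟩
  rw [← (hW x).2]
  simp only [Fintype.sum_prod_type, WZ1]
  exact Finset.sum_comm

lemma tw_WZ2_chan {X Y Z₁ Z₂ : Type} [Fintype X] [Fintype Y] [Fintype Z₁] [Fintype Z₂]
    {W : X → Y × Z₁ × Z₂ → ℝ} (hW : IsChannel W) : IsChannel (WZ2 W) := by
  refine fun x => ⟨fun y => Finset.sum_nonneg fun _ _ => Finset.sum_nonneg fun _ _ => (hW x).1 _, ?_⟩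
  rw [← (hW x).2]
  simp only [Fintype.sum_prod_type, WZ2]
  rw [Finset.sum_comm]
  refine Finset.sum_congr rfl fun _ _ => ?_
  exact Finset.sum_comm

lemma tw_leak1_triv {X Y Z₁ Z₂ : Type} [Fintype X] [Fintype Y] [Fintype Z₁] [Fintype Z₂]
    {W : X → Y × Z₁ × Z₂ → ℝ} (hW : IsChannel W) {n K₁ K₂ : ℕ} (h1 : K₁ = 1) (h2 : 0 < K₂)
    (enc : Fin K₁ × Fin K₂ → (Fin n → X) → ℝ) (henc : IsChannel enc) :
    leakM1Z1 W enc = 0 := by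
  subst h1
  refine tw_mutInfo_subsing _ fun a => ?_
  unfold codeJoint
  simp only [← Finset.mul_sum, tw_prodZ1]
  rw [Finset.sum_comm]
  have h : ∀ m₂ : Fin K₂, ∑ z : Fin n → Z₁, ∑ xs, (((1:ℕ):ℝ) * (K₂:ℝ))⁻¹ * enc (a, m₂) xs *
      twPowK n (WZ1 W) xs z = (K₂ : ℝ)⁻¹ := by
    intro m₂
    rw [Finset.sum_comm]
    simp only [← Finset.mul_sum, (twPowK_chan n (tw_WZ1_chan hW) _).2, mul_one, (henc _).2]
    simp
  simp only [h]
  have : (K₂ : ℝ) ≠ 0 := by positivity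
  simp [this]

lemma tw_leak2_triv {X Y Z₁ Z₂ : Type} [Fintype X] [Fintype Y] [Fintype Z₁] [Fintype Z₂]
    {W : X → Y × Z₁ × Z₂ → ℝ} (hW : IsChannel W) {n : ℕ}
    (enc : Fin 1 × Fin 1 → (Fin n → X) → ℝ) (henc : IsChannel enc) :
    leakMZ2 W enc = 0 := by
  refine tw_mutInfo_subsing _ fun a => ?_
  unfold codeJoint
  simp only [← Finset.mul_sum, tw_prodZ2]
  rw [Finset.sum_comm]
  simp only [← Finset.mul_sum, (twPowK_chan n (tw_WZ2_chan hW) _).2, mul_one, (henc _).2]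
  simp

set_option maxHeartbeats 1600000 in
lemma tw_core {X Y Z₁ Z₂ U V : Type} [Fintype X] [Fintype Y] [Fintype Z₁] [Fintype Z₂]
    [Fintype U] [Fintype V]
    {W : X → Y × Z₁ × Z₂ → ℝ} (hW : IsChannel W) {PU : U → ℝ} {K : U → V → ℝ} {P : V → X → ℝ}
    (hPU : IsPMF PU) (hK : IsChannel K) (hP : IsChannel P) (r1 ra rb rt rs : ℝ)
    (h1 : 0 ≤ r1) (ha : 0 ≤ ra) (hb : 0 ≤ rb) (ht : 0 ≤ rt) (hs : 0 ≤ rs)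
    (c1 : r1 + rb + rs < twIC PU K (twQU P (WY W)))
    (c2 : r1 + ra + rb + rs + rt < twIV PU K (twQU P (WY W)))
    (c3 : twIU PU K (twQU P (WZ2 W)) ≤ rt)
    (c4 : twIV PU K (twQU P (WZ2 W)) ≤ rt + rs)
    (c5 : r1 = 0 ∨ twIC PU K (twQU P (WZ1 W)) ≤ rb + rs) (ε : ℝ) (hε : 0 < ε) :
    ∃ n : ℕ, 0 < n ∧ ∃ K₁ K₂ : ℕ, 0 < K₁ ∧ 0 < K₂ ∧
    (n : ℝ) * r1 ≤ Real.logb 2 K₁ ∧ (n : ℝ) * (ra + rb) ≤ Real.logb 2 K₂ ∧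
    ∃ enc : Fin K₁ × Fin K₂ → (Fin n → X) → ℝ, IsChannel enc ∧
      ∃ dec : (Fin n → Y) → Fin K₁ × Fin K₂,
        errProb W enc dec ≤ ε ∧
        leakMZ2 W enc ≤ (n : ℝ) * ε ∧
        leakM1Z1 W enc ≤ (n : ℝ) * ε := by
  have hQY := tw_QU_chan hP (tw_WY_chan hW)
  have hQ1 := tw_QU_chan hP (tw_WZ1_chan hW)
  have hQ2 := tw_QU_chan hP (tw_WZ2_chan hW)
  set QY := twQU P (WY W) with hQYd
  set Q1 := twQU P (WZ1 W) with hQ1d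
  set Q2 := twQU P (WZ2 W) with hQ2d
  obtain ⟨δ, hδ, d1, d2⟩ : ∃ δ : ℝ, 0 < δ ∧ r1 + rb + rs + 2 * δ ≤ twIC PU K QY ∧
      r1 + ra + rb + rs + rt + 2 * δ ≤ twIV PU K QY := by
    refine ⟨min (twIC PU K QY - (r1 + rb + rs)) (twIV PU K QY - (r1 + ra + rb + rs + rt)) / 2,
      ?_, ?_, ?_⟩
    · have := lt_min (sub_pos.mpr c1) (sub_pos.mpr c2)
      linarith
    · linarith [min_le_left (twIC PU K QY - (r1 + rb + rs)) (twIV PU K QY - (r1 + ra + rb + rs + rt))]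
    · linarith [min_le_right (twIC PU K QY - (r1 + rb + rs)) (twIV PU K QY - (r1 + ra + rb + rs + rt))]
  set η := ε / 6 with hη
  have hη0 : 0 < η := by positivity
  set v0 := twVar (twW PU K QY) (twFC K QY) + twVar (twW PU K QY) (twFV PU K QY) with hv0
  set v2 := twVar (twW PU K Q2) (twFV PU K Q2) + twVar (twW PU K Q2) (twFU PU K Q2) with hv2
  set v1 := twVar (twW PU K Q1) (twFC K Q1) with hv1
  have hv1n : 0 ≤ v1 := tw_var_nonneg (twW_pmf hPU hK hQ1) _
  obtain ⟨n, hn, hC⟩ := tw_large (v0 / δ ^ 2 + (2 + v2 / η) + (2 + v1 / η)) δ (ε / 2) hδ (by linarith)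
  have hn' : (0:ℝ) < n := by exact_mod_cast hn
  have i1 : NeZero (twN n r1) := ⟨(twN_pos _ _).ne'⟩
  have i2 : NeZero (twN n ra) := ⟨(twN_pos _ _).ne'⟩
  have i3 : NeZero (twN n rb) := ⟨(twN_pos _ _).ne'⟩
  have i4 : NeZero (twN n rt) := ⟨(twN_pos _ _).ne'⟩
  have i5 : NeZero (twN n rs) := ⟨(twN_pos _ _).ne'⟩
  set mu : ℝ := if r1 = 0 then 0 else (n : ℝ)⁻¹ with hmu
  have hmu0 : 0 ≤ mu := by rw [hmu]; split_ifs <;> positivity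
  obtain ⟨c, d, hc1, hc2, hcd⟩ := tw_oneshot (M := Fin (twN n r1)) (A := Fin (twN n ra))
    (B := Fin (twN n rb)) (T := Fin (twN n rt)) (S := Fin (twN n rs))
    (twPow_pmf n hPU) (twPowK_chan n hK) (twPowK_chan n hQY) (twPowK_chan n hQ1)
    (twPowK_chan n hQ2) ((2:ℝ) ^ (n * (twIC PU K QY - δ))) ((2:ℝ) ^ (n * (twIV PU K QY - δ)))
    (n:ℝ)⁻¹ mu (by positivity) (by positivity) (by positivity) hmu0
  have e0 := tw_bad hPU hK hQY n hn δ hδ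
  have e2 := tw_b2 hPU hK hQ2 n hn η hη0 (twN n rt) (twN n rs) (by exact_mod_cast twN_pos _ _)
    (by exact_mod_cast twN_pos _ _)
    (le_trans (Real.rpow_le_rpow_of_exponent_le (by norm_num) (by gcongr)) (twN_lo n rt))
    (by
      refine le_trans (Real.rpow_le_rpow_of_exponent_le (by norm_num)
        (mul_le_mul_of_nonneg_left c4 hn'.le)) ?_
      rw [mul_add, Real.rpow_add (by norm_num)]
      exact mul_le_mul (twN_lo _ _) (twN_lo _ _) (by positivity) (by positivity))
  simp only [Fintype.card_prod, Fintype.card_fin] at hcd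
  push_cast at hcd
  have e1 : mu * (∑ u, ∑ v, ∑ z, twPow n PU u * twPowK n K u v * twPowK n Q1 v z *
      Real.logb 2 ((twQU (twPowK n K) (twPowK n Q1) u z)⁻¹ *
        (((twN n rb : ℝ) * (twN n rs : ℝ))⁻¹ * twPowK n Q1 v z + twQU (twPowK n K) (twPowK n Q1) u z)))
      ≤ (n:ℝ)⁻¹ * (2 + n * η + v1 / η) := by
    rcases c5 with h0 | h0
    · have : mu = 0 := by rw [hmu, if_pos h0]
      rw [this, zero_mul]
      positivity
    · have e := tw_b1 hPU hK hQ1 n hn η hη0 ((twN n rb : ℝ) * (twN n rs : ℝ))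
        (mul_pos (by exact_mod_cast twN_pos _ _) (by exact_mod_cast twN_pos _ _))
        (by
          refine le_trans (Real.rpow_le_rpow_of_exponent_le (by norm_num)
            (mul_le_mul_of_nonneg_left h0 hn'.le)) ?_
          rw [mul_add, Real.rpow_add (by norm_num)]
          exact mul_le_mul (twN_lo _ _) (twN_lo _ _) (by positivity) (by positivity))
      refine le_trans (mul_le_mul_of_nonneg_left e hmu0) ?_
      refine mul_le_mul_of_nonneg_right ?_ (by positivity)
      rw [hmu]; split_ifs
      · positivity
      · exact le_rfl
  have g1 : (twN n r1 : ℝ) * ((twN n rb : ℝ) * (twN n rs : ℝ)) ≤ 8 * (2:ℝ) ^ (n * (r1 + rb + rs)) := by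
    have : (2:ℝ) ^ (n * (r1 + rb + rs)) = (2:ℝ) ^ (n * r1) * ((2:ℝ) ^ (n * rb) * (2:ℝ) ^ (n * rs)) := by
      rw [← Real.rpow_add (by norm_num), ← Real.rpow_add (by norm_num)]; congr 1; ring
    rw [this]
    calc _ ≤ (2 * (2:ℝ) ^ (n * r1)) * ((2 * (2:ℝ) ^ (n * rb)) * (2 * (2:ℝ) ^ (n * rs))) := by
          gcongr <;> exact twN_hi _ _ (by assumption)
      _ = _ := by ring
  have g2 : (twN n ra : ℝ) * (twN n rt : ℝ) ≤ 4 * (2:ℝ) ^ (n * (ra + rt)) := by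
    have : (2:ℝ) ^ (n * (ra + rt)) = (2:ℝ) ^ (n * ra) * (2:ℝ) ^ (n * rt) := by
      rw [← Real.rpow_add (by norm_num)]; congr 1; ring
    rw [this]
    calc _ ≤ (2 * (2:ℝ) ^ (n * ra)) * (2 * (2:ℝ) ^ (n * rt)) := by
          gcongr <;> exact twN_hi _ _ (by assumption)
      _ = _ := by ring
  have f1 : (twN n r1 : ℝ) * ((twN n rb : ℝ) * (twN n rs : ℝ)) *
      ((2:ℝ) ^ (n * (twIC PU K QY - δ)))⁻¹ ≤ 8 * (2:ℝ) ^ (-(n * δ)) := by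
    rw [← Real.rpow_neg (by norm_num)]
    calc _ ≤ 8 * (2:ℝ) ^ (n * (r1 + rb + rs)) * (2:ℝ) ^ (-(n * (twIC PU K QY - δ))) := by gcongr
      _ = 8 * (2:ℝ) ^ (n * (r1 + rb + rs) + -(n * (twIC PU K QY - δ))) := by
          rw [mul_assoc, ← Real.rpow_add (by norm_num)]
      _ ≤ _ := by
          refine mul_le_mul_of_nonneg_left (Real.rpow_le_rpow_of_exponent_le (by norm_num) ?_) (by norm_num)
          nlinarith
  have f2 : (twN n ra : ℝ) * (twN n rt : ℝ) * ((twN n r1 : ℝ) * ((twN n rb : ℝ) * (twN n rs : ℝ))) *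
      ((2:ℝ) ^ (n * (twIV PU K QY - δ)))⁻¹ ≤ 32 * (2:ℝ) ^ (-(n * δ)) := by
    rw [← Real.rpow_neg (by norm_num)]
    calc _ ≤ (4 * (2:ℝ) ^ (n * (ra + rt))) * (8 * (2:ℝ) ^ (n * (r1 + rb + rs))) *
            (2:ℝ) ^ (-(n * (twIV PU K QY - δ))) := by gcongr
      _ = 32 * (2:ℝ) ^ (n * (ra + rt) + n * (r1 + rb + rs) + -(n * (twIV PU K QY - δ))) := by
          rw [Real.rpow_add (by norm_num), Real.rpow_add (by norm_num)]; ring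
      _ ≤ _ := by
          refine mul_le_mul_of_nonneg_left (Real.rpow_le_rpow_of_exponent_le (by norm_num) ?_) (by norm_num)
          nlinarith
  have e2' := mul_le_mul_of_nonneg_left e2 (show (0:ℝ) ≤ (n:ℝ)⁻¹ by positivity)
  have htot : twErr (twPowK n QY) c d + (n:ℝ)⁻¹ * twD2 (twPow n PU) (twPowK n K) (twPowK n Q2) c
      + mu * twD1 (twPowK n K) (twPowK n Q1) c ≤ ε := by
    have hfin : v0 / (n * δ ^ 2) + 8 * (2:ℝ) ^ (-(n * δ)) + 32 * (2:ℝ) ^ (-(n * δ))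
        + (n:ℝ)⁻¹ * (2 + 2 * (n * η) + v2 / η) + (n:ℝ)⁻¹ * (2 + n * η + v1 / η) ≤ ε := by
      have : v0 / (n * δ ^ 2) + (n:ℝ)⁻¹ * (2 + 2 * (n * η) + v2 / η)
          + (n:ℝ)⁻¹ * (2 + n * η + v1 / η) =
          (v0 / δ ^ 2 + (2 + v2 / η) + (2 + v1 / η)) / n + 3 * η := by
        field_simp
        ring
      linarith
    exact hcd.trans ((add_le_add (add_le_add (add_le_add (add_le_add e0 f1) f2) e2') e1).trans hfin)
  have n0 : 0 ≤ twErr (twPowK n QY) c d := by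
    refine mul_nonneg (by positivity) (Finset.sum_nonneg fun x _ => Finset.sum_nonneg fun y _ =>
      mul_nonneg ((twPowK_chan n hQY _).1 _) (by split_ifs <;> norm_num))
  have n2 := tw_D2_nonneg (twPow_pmf n hPU) (twPowK_chan n hK) (twPowK_chan n hQ2) c hc1 hc2
  have n1 := tw_D1_nonneg (twPowK_chan n hK) (twPowK_chan n hQ1) c hc2
  have n1' := mul_nonneg hmu0 n1
  have n2' := mul_nonneg (show (0:ℝ) ≤ (n:ℝ)⁻¹ by positivity) n2
  have henc : IsChannel (twEnc P c) := fun m => tw_P2_chan (twPowK_chan n hP) c _ _ _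
  have hKK : 0 < twN n ra * twN n rb := Nat.mul_pos (twN_pos _ _) (twN_pos _ _)
  refine ⟨n, hn, twN n r1, twN n ra * twN n rb, twN_pos _ _, hKK, twN_log _ _, ?_,
    twEnc P c, henc, twDec d, ?_, ?_, ?_⟩
  · push_cast
    rw [Real.logb_mul (by exact_mod_cast (twN_pos _ _).ne') (by exact_mod_cast (twN_pos _ _).ne')]
    linarith [twN_log n ra, twN_log n rb]
  · have := tw_err_bridge W hQY c d
    linarith
  · refine (tw_leak2_bridge W hPU hK hQ2 c hc1 hc2).trans ?_
    have : (n:ℝ)⁻¹ * twD2 (twPow n PU) (twPowK n K) (twPowK n Q2) c ≤ ε := by linarith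
    rwa [inv_mul_le_iff₀ hn'] at this
  · by_cases hr : r1 = 0
    · rw [tw_leak1_triv hW (by rw [hr, twN_zero]) hKK _ henc]
      positivity
    · refine (tw_leak1_bridge W hK hQ1 c hc2).trans ?_
      have : mu * twD1 (twPowK n K) (twPowK n Q1) c ≤ ε := by linarith
      rw [hmu, if_neg hr] at this
      rwa [inv_mul_le_iff₀ hn'] at this

section info
variable {U V Z : Type} [Fintype U] [Fintype V] [Fintype Z]

lemma twIU_eq (PU : U → ℝ) (K : U → V → ℝ) (Q : V → Z → ℝ) :
    twIU PU K Q = ∑ u, PU u * ∑ z, twQU K Q u z * Real.logb 2 (twQU K Q u z / twQP PU K Q z) := by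
  unfold twIU twW twFU
  simp only [Fintype.sum_prod_type]
  refine Finset.sum_congr rfl fun u _ => ?_
  rw [Finset.sum_comm, Finset.mul_sum]
  refine Finset.sum_congr rfl fun z _ => ?_
  rw [← Finset.sum_mul]
  simp only [mul_assoc, ← Finset.mul_sum]
  rfl

lemma twIC_eq (PU : U → ℝ) (K : U → V → ℝ) (Q : V → Z → ℝ) :
    twIC PU K Q = ∑ u, ∑ v, PU u * K u v * ∑ z, Q v z * Real.logb 2 (Q v z / twQU K Q u z) := by
  unfold twIC twW twFC
  simp only [Fintype.sum_prod_type, mul_assoc, Finset.mul_sum]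

lemma twIV_eq (PU : U → ℝ) (K : U → V → ℝ) (Q : V → Z → ℝ) :
    twIV PU K Q = ∑ v, (∑ u, PU u * K u v) * ∑ z, Q v z * Real.logb 2 (Q v z / twQP PU K Q z) := by
  unfold twIV twW twFV
  simp only [Fintype.sum_prod_type, mul_assoc, Finset.mul_sum, Finset.sum_mul]
  rw [Finset.sum_comm]
  refine Finset.sum_congr rfl fun v _ => ?_
  rw [Finset.sum_comm]

lemma twQP_eq (PU : U → ℝ) (K : U → V → ℝ) (Q : V → Z → ℝ) (z : Z) :
    twQP PU K Q z = ∑ v, (∑ u, PU u * K u v) * Q v z := by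
  unfold twQP twQU
  simp only [Finset.mul_sum, Finset.sum_mul, mul_assoc]
  rw [Finset.sum_comm]

lemma twIV_chain {PU : U → ℝ} {K : U → V → ℝ} {Q : V → Z → ℝ} (hPU : IsPMF PU)
    (hK : IsChannel K) (hQ : IsChannel Q) : twIV PU K Q = twIU PU K Q + twIC PU K Q := by
  unfold twIV twIU twIC
  rw [← Finset.sum_add_distrib]
  refine Finset.sum_congr rfl fun ω _ => ?_
  rw [← mul_add]
  by_cases h : twW PU K Q ω = 0
  · simp [h]
  · congr 1
    have h0 := tw_supp (n := 1) hPU hK hQ (fun _ => ω) (by simpa using h) 0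
    obtain ⟨a, b, c⟩ := h0
    unfold twFV twFU twFC
    rw [Real.logb_div a.ne' c.ne', Real.logb_div b.ne' c.ne', Real.logb_div a.ne' b.ne']
    ring

lemma twIU_nonneg {PU : U → ℝ} {K : U → V → ℝ} {Q : V → Z → ℝ} (hPU : IsPMF PU)
    (hK : IsChannel K) (hQ : IsChannel Q) : 0 ≤ twIU PU K Q := by
  rw [twIU_eq]
  refine Finset.sum_nonneg fun u _ => ?_
  rcases (hPU.1 u).eq_or_lt with h | h
  · rw [← h, zero_mul]
  · refine mul_nonneg h.le (tw_kl_nonneg _ _ (tw_QU_chan hK hQ u).1 (tw_QP_pmf hPU hK hQ).1 ?_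
      (tw_QU_chan hK hQ u).2 (tw_QP_pmf hPU hK hQ).2)
    exact fun z hz => tw_QP_pos hPU hK hQ h hz

lemma twIC_nonneg {PU : U → ℝ} {K : U → V → ℝ} {Q : V → Z → ℝ} (hPU : IsPMF PU)
    (hK : IsChannel K) (hQ : IsChannel Q) : 0 ≤ twIC PU K Q := by
  rw [twIC_eq]
  refine Finset.sum_nonneg fun u _ => Finset.sum_nonneg fun v _ => ?_
  rcases ((hK u).1 v).eq_or_lt with h | h
  · rw [← h, mul_zero, zero_mul]
  · refine mul_nonneg (mul_nonneg (hPU.1 u) h.le) (tw_kl_nonneg _ _ (hQ v).1 (tw_QU_chan hK hQ u).1 ?_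
      (hQ v).2 (tw_QU_chan hK hQ u).2)
    exact fun z hz => tw_QU_pos hK hQ h hz

lemma twIC_dpi {Z' : Type} [Fintype Z'] {PU : U → ℝ} {K : U → V → ℝ} {Q : V → Z → ℝ}
    (hPU : IsPMF PU) (hK : IsChannel K) (hQ : IsChannel Q) {q : Z → Z' → ℝ} (hq : IsChannel q) :
    twIC PU K (twQU Q q) ≤ twIC PU K Q := by
  rw [twIC_eq, twIC_eq]
  refine Finset.sum_le_sum fun u _ => Finset.sum_le_sum fun v _ => ?_
  rcases ((hK u).1 v).eq_or_lt with h | h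
  · rw [← h]; simp
  refine mul_le_mul_of_nonneg_left ?_ (mul_nonneg (hPU.1 u) h.le)
  have hU : ∀ z', twQU K (twQU Q q) u z' = ∑ z, twQU K Q u z * q z z' := by
    intro z'
    unfold twQU
    simp only [Finset.mul_sum, Finset.sum_mul, mul_assoc]
    rw [Finset.sum_comm]
  calc ∑ z', twQU Q q v z' * Real.logb 2 (twQU Q q v z' / twQU K (twQU Q q) u z')
      ≤ ∑ z', ∑ z, Q v z * q z z' * Real.logb 2 ((Q v z * q z z') / (twQU K Q u z * q z z')) := by
        refine Finset.sum_le_sum fun z' _ => ?_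
        rw [hU]
        refine tw_logsum (fun z => Q v z * q z z') (fun z => twQU K Q u z * q z z')
          (fun z => mul_nonneg ((hQ v).1 z) ((hq z).1 z'))
          (fun z => mul_nonneg ((tw_QU_chan hK hQ u).1 z) ((hq z).1 z')) ?_
        intro z hz
        have h1 : 0 < Q v z := lt_of_le_of_ne ((hQ v).1 z) (fun h0 => by simp [← h0] at hz)
        have h2 : 0 < q z z' := lt_of_le_of_ne ((hq z).1 z') (fun h0 => by simp [← h0] at hz)
        exact mul_pos (tw_QU_pos hK hQ h h1) h2
    _ = ∑ z', ∑ z, Q v z * q z z' * Real.logb 2 (Q v z / twQU K Q u z) := by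
        refine Finset.sum_congr rfl fun z' _ => Finset.sum_congr rfl fun z _ => ?_
        by_cases h0 : q z z' = 0
        · simp [h0]
        · rw [mul_div_mul_right _ _ h0]
    _ = _ := by
        rw [Finset.sum_comm]
        refine Finset.sum_congr rfl fun z _ => ?_
        rw [← Finset.sum_mul, ← Finset.mul_sum, (hq z).2, mul_one]

lemma tw_mi_U {PU : U → ℝ} {K : U → V → ℝ} {Q : V → Z → ℝ}
    (hK : IsChannel K) (hQ : IsChannel Q) (J : U × Z → ℝ)
    (hJ : ∀ u z, J (u, z) = ∑ v, PU u * K u v * Q v z) : mutInfo J = twIU PU K Q := by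
  have hJ' : ∀ u z, J (u, z) = PU u * twQU K Q u z := by
    intro u z; rw [hJ]; simp only [mul_assoc, ← Finset.mul_sum]; rfl
  rw [twIU_eq]
  unfold mutInfo
  rw [Fintype.sum_prod_type]
  refine Finset.sum_congr rfl fun u _ => ?_
  rw [Finset.mul_sum]
  refine Finset.sum_congr rfl fun z _ => ?_
  simp only [hJ', ← Finset.mul_sum, (tw_QU_chan hK hQ _).2, mul_one]
  change _ * Real.logb 2 (_ / (_ * twQP PU K Q z)) = _
  by_cases h : PU u = 0
  · simp [h]
  · rw [mul_div_mul_left _ _ h, mul_assoc]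

lemma tw_mi_V {PU : U → ℝ} {K : U → V → ℝ} {Q : V → Z → ℝ}
    (hQ : IsChannel Q) (J : V × Z → ℝ)
    (hJ : ∀ v z, J (v, z) = ∑ u, PU u * K u v * Q v z) : mutInfo J = twIV PU K Q := by
  have hJ' : ∀ v z, J (v, z) = (∑ u, PU u * K u v) * Q v z := by
    intro u z; rw [hJ, Finset.sum_mul]
  rw [twIV_eq]
  unfold mutInfo
  rw [Fintype.sum_prod_type]
  refine Finset.sum_congr rfl fun v _ => ?_
  rw [Finset.mul_sum]
  refine Finset.sum_congr rfl fun z _ => ?_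
  simp only [hJ', ← twQP_eq]
  simp only [← Finset.mul_sum, (hQ _).2, mul_one]
  by_cases h : (∑ u, PU u * K u v) = 0
  · simp [h]
  · rw [mul_div_mul_left _ _ h, mul_assoc]

lemma tw_mi_C {PU : U → ℝ} {K : U → V → ℝ} {Q : V → Z → ℝ}
    (hK : IsChannel K) (hQ : IsChannel Q) (J : V × Z × U → ℝ)
    (hJ : ∀ v z u, J (v, z, u) = PU u * K u v * Q v z) : condMutInfo J = twIC PU K Q := by
  rw [twIC_eq]
  unfold condMutInfo
  simp only [Fintype.sum_prod_type, hJ]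
  rw [Finset.sum_comm (s := (Finset.univ : Finset U))]
  refine Finset.sum_congr rfl fun v _ => ?_
  rw [Finset.sum_comm]
  refine Finset.sum_congr rfl fun u _ => ?_
  rw [Finset.mul_sum]
  refine Finset.sum_congr rfl fun z _ => ?_
  have e1 : ∑ a, PU u * K u a * Q a z = PU u * twQU K Q u z := by
    simp only [mul_assoc, ← Finset.mul_sum]; rfl
  simp only [e1, ← Finset.mul_sum, (hQ _).2, mul_one, (hK _).2]
  by_cases h : PU u * K u v = 0
  · simp [h]
  · have h1 := left_ne_zero_of_mul h
    have : PU u * (PU u * K u v * Q v z) / (PU u * K u v * (PU u * twQU K Q u z)) =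
        Q v z / twQU K Q u z := by
      rw [show PU u * (PU u * K u v * Q v z) = (PU u * (PU u * K u v)) * Q v z by ring,
        show PU u * K u v * (PU u * twQU K Q u z) = (PU u * (PU u * K u v)) * twQU K Q u z by ring,
        mul_div_mul_left _ _ (mul_ne_zero h1 h)]
    rw [this, mul_assoc]

/-- with a trivial cloud variable -/
def twK0 (PU : U → ℝ) (K : U → V → ℝ) (_ : Unit) (v : V) : ℝ := ∑ u, PU u * K u v

lemma twK0_chan {PU : U → ℝ} {K : U → V → ℝ} (hPU : IsPMF PU) (hK : IsChannel K) :
    IsChannel (twK0 PU K) := by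
  refine fun _ => ⟨fun v => Finset.sum_nonneg fun u _ => mul_nonneg (hPU.1 u) ((hK u).1 v), ?_⟩
  unfold twK0
  rw [Finset.sum_comm]
  simp only [← Finset.mul_sum, (hK _).2, mul_one, hPU.2]

lemma tw_one_pmf : IsPMF (fun _ : Unit => (1:ℝ)) := ⟨fun _ => zero_le_one, by simp⟩

lemma twQU0 (PU : U → ℝ) (K : U → V → ℝ) (Q : V → Z → ℝ) (a : Unit) (z : Z) :
    twQU (twK0 PU K) Q a z = twQP PU K Q z := by rw [twQP_eq]; rfl

lemma twQP0 (PU : U → ℝ) (K : U → V → ℝ) (Q : V → Z → ℝ) (z : Z) :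
    twQP (fun _ : Unit => (1:ℝ)) (twK0 PU K) Q z = twQP PU K Q z := by
  unfold twQP
  simp [twQU0]
  rfl

lemma twIU0 (PU : U → ℝ) (K : U → V → ℝ) (Q : V → Z → ℝ) :
    twIU (fun _ : Unit => (1:ℝ)) (twK0 PU K) Q = 0 := by
  rw [twIU_eq]
  simp only [twQU0, twQP0]
  refine Finset.sum_eq_zero fun _ _ => ?_
  rw [one_mul]
  refine Finset.sum_eq_zero fun z _ => ?_
  by_cases h : twQP PU K Q z = 0
  · simp [h]
  · simp [div_self h]

lemma twIC0 (PU : U → ℝ) (K : U → V → ℝ) (Q : V → Z → ℝ) :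
    twIC (fun _ : Unit => (1:ℝ)) (twK0 PU K) Q = twIV PU K Q := by
  rw [twIC_eq, twIV_eq]
  simp only [twQU0]
  simp [twK0]

lemma twIV0 (PU : U → ℝ) (K : U → V → ℝ) (Q : V → Z → ℝ) :
    twIV (fun _ : Unit => (1:ℝ)) (twK0 PU K) Q = twIV PU K Q := by
  rw [twIV_eq, twIV_eq]
  simp only [twQP0]
  simp [twK0]

end info

lemma tw_factor {U V X : Type} [Fintype U] [Fintype V] [Fintype X] (p : U × V × X → ℝ)
    (hp : IsPMF p)
    (hM : ∀ u v x, p (u, v, x) * (∑ u', ∑ x', p (u', v, x')) =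
        (∑ x', p (u, v, x')) * (∑ u', p (u', v, x))) :
    ∃ (PU : U → ℝ) (K : U → V → ℝ) (P : V → X → ℝ), IsPMF PU ∧ IsChannel K ∧ IsChannel P ∧
      ∀ u v x, p (u, v, x) = PU u * K u v * P v x := by
  classical
  have hp1 : ∑ u, ∑ v, ∑ x, p (u, v, x) = 1 := by
    rw [← hp.2]; simp only [Fintype.sum_prod_type]
  set PU : U → ℝ := fun u => ∑ v, ∑ x, p (u, v, x) with hPU
  set PV : V → ℝ := fun v => ∑ u, ∑ x, p (u, v, x) with hPV
  set PX : X → ℝ := fun x => ∑ v, ∑ u, p (u, v, x) with hPX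
  have nU : ∀ u, 0 ≤ PU u := fun u => Finset.sum_nonneg fun _ _ => Finset.sum_nonneg fun _ _ => hp.1 _
  have nV : ∀ v, 0 ≤ PV v := fun u => Finset.sum_nonneg fun _ _ => Finset.sum_nonneg fun _ _ => hp.1 _
  have nX : ∀ x, 0 ≤ PX x := fun u => Finset.sum_nonneg fun _ _ => Finset.sum_nonneg fun _ _ => hp.1 _
  have sV : ∑ v, PV v = 1 := by rw [hPV, Finset.sum_comm]; exact hp1
  have sX : ∑ x, PX x = 1 := by
    rw [← sV, hPX, Finset.sum_comm]
    refine Finset.sum_congr rfl fun v _ => ?_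
    rw [Finset.sum_comm]
  have nUV : ∀ u v, 0 ≤ ∑ x, p (u, v, x) := fun u v => Finset.sum_nonneg fun _ _ => hp.1 _
  refine ⟨PU, fun u v => if PU u = 0 then PV v else (∑ x, p (u, v, x)) / PU u,
    fun v x => if PV v = 0 then PX x else (∑ u, p (u, v, x)) / PV v, ⟨nU, hp1⟩, ?_, ?_, ?_⟩
  · intro u
    by_cases h : PU u = 0
    · simp only [if_pos h]; exact ⟨nV, sV⟩
    · simp only [if_neg h]
      refine ⟨fun v => div_nonneg (nUV u v) (nU u), ?_⟩
      rw [← Finset.sum_div]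
      exact div_self h
  · intro v
    by_cases h : PV v = 0
    · simp only [if_pos h]; exact ⟨nX, sX⟩
    · simp only [if_neg h]
      refine ⟨fun x => div_nonneg (Finset.sum_nonneg fun _ _ => hp.1 _) (nV v), ?_⟩
      rw [← Finset.sum_div, Finset.sum_comm]
      exact div_self h
  · intro u v x
    have hUV : PU u * (if PU u = 0 then PV v else (∑ x, p (u, v, x)) / PU u) = ∑ x, p (u, v, x) := by
      by_cases h : PU u = 0
      · rw [if_pos h, h, zero_mul]
        exact ((Finset.sum_eq_zero_iff_of_nonneg (fun v _ => nUV u v)).mp h v (Finset.mem_univ v)).symm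
      · rw [if_neg h, mul_div_cancel₀ _ h]
    simp only [hUV]
    by_cases h : PV v = 0
    · have h0 : ∑ x, p (u, v, x) = 0 :=
        (Finset.sum_eq_zero_iff_of_nonneg (fun u _ => nUV u v)).mp h u (Finset.mem_univ u)
      rw [h0, zero_mul]
      exact (Finset.sum_eq_zero_iff_of_nonneg (fun x _ => hp.1 _)).mp h0 x (Finset.mem_univ x)
    · rw [if_neg h, ← mul_div_assoc, eq_div_iff h]
      exact hM u v x

lemma tw_achieve {X Y Z₁ Z₂ U V : Type} [Fintype X] [Fintype Y] [Fintype Z₁] [Fintype Z₂]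
    [Fintype U] [Fintype V]
    {W : X → Y × Z₁ × Z₂ → ℝ} (hW : IsChannel W) {PU : U → ℝ} {K : U → V → ℝ} {P : V → X → ℝ}
    (hPU : IsPMF PU) (hK : IsChannel K) (hP : IsChannel P) (R₁ R₂ : ℝ)
    (hR₁ : 0 ≤ R₁) (hR₂ : 0 ≤ R₂)
    (hdpi : twIC PU K (twQU P (WZ2 W)) ≤ twIC PU K (twQU P (WZ1 W)))
    (hU : twIU PU K (twQU P (WZ2 W)) ≤ twIU PU K (twQU P (WY W)))
    (h1 : R₁ ≤ twIC PU K (twQU P (WY W)) - twIC PU K (twQU P (WZ1 W)))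
    (h2 : R₁ + R₂ ≤ twIV PU K (twQU P (WY W)) - twIV PU K (twQU P (WZ2 W))) :
    Achievable W R₁ R₂ := by
  have hQY := tw_QU_chan hP (tw_WY_chan hW)
  have hQ2 := tw_QU_chan hP (tw_WZ2_chan hW)
  have chY := twIV_chain hPU hK hQY
  have ch2 := twIV_chain hPU hK hQ2
  have nU2 := twIU_nonneg hPU hK hQ2
  have nC2 := twIC_nonneg hPU hK hQ2
  intro ε hε
  have key : ∀ a b c : ℝ, 0 ≤ a → b ≤ c → a * b ≤ a * c := fun a b c ha h =>
    mul_le_mul_of_nonneg_left h ha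
  rcases hR₁.eq_or_lt with h0 | hpos
  · rcases hR₂.eq_or_lt with h0' | hpos'
    · -- trivial code
      have henc : IsChannel (fun (_ : Fin 1 × Fin 1) => twPow 1 (twQP PU K P)) :=
        fun _ => twPow_pmf 1 (tw_QP_pmf hPU hK hP)
      refine ⟨1, one_pos, 1, 1, one_pos, one_pos, ?_, ?_, _, henc, fun _ => (0, 0), ?_, ?_, ?_⟩
      · simp [← h0, hε.le]
      · simp [← h0', hε.le]
      · have : errProb W (n := 1) (fun (_ : Fin 1 × Fin 1) => twPow 1 (twQP PU K P)) (fun _ => (0, 0)) = 0 := by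
          unfold errProb
          refine Finset.sum_eq_zero fun m _ => Finset.sum_eq_zero fun _ _ =>
            Finset.sum_eq_zero fun _ _ => Finset.sum_eq_zero fun _ _ => Finset.sum_eq_zero fun _ _ => ?_
          rw [if_neg]
          exact not_not.mpr (Subsingleton.elim _ _)
        rw [this]; exact hε.le
      · rw [tw_leak2_triv hW _ henc]; positivity
      · rw [tw_leak1_triv hW rfl one_pos _ henc]; positivity
    · have hd : 0 < min ε R₂ := lt_min hε hpos'
      have hd1 := min_le_left ε R₂
      have hd2 := min_le_right ε R₂
      obtain ⟨n, hn, K₁, K₂, hK1, hK2, l1, l2, rest⟩ := tw_core hW tw_one_pmf (twK0_chan hPU hK) hP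
        0 0 (R₂ - min ε R₂) 0 (twIV PU K (twQU P (WZ2 W))) le_rfl le_rfl (by linarith) le_rfl
        (by linarith) (by rw [twIC0]; linarith) (by rw [twIV0]; linarith)
        (by rw [twIU0]) (by rw [twIV0]; linarith) (Or.inl rfl) ε hε
      refine ⟨n, hn, K₁, K₂, hK1, hK2, le_trans (key _ _ _ n.cast_nonneg ?_) l1,
        le_trans (key _ _ _ n.cast_nonneg ?_) l2, rest⟩
      · linarith
      · linarith
  · have hd : 0 < min ε R₁ := lt_min hε hpos
    have hd1 := min_le_left ε R₁
    have hd2 := min_le_right ε R₁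
    set J1 := twIC PU K (twQU P (WZ1 W))
    set J2 := twIC PU K (twQU P (WZ2 W))
    have hb1 := min_le_left R₂ (J1 - J2)
    have hb2 := min_le_right R₂ (J1 - J2)
    have hb0 : 0 ≤ min R₂ (J1 - J2) := le_min hR₂ (by linarith)
    obtain ⟨n, hn, K₁, K₂, hK1, hK2, l1, l2, rest⟩ := tw_core hW hPU hK hP
      (R₁ - min ε R₁) (R₂ - min R₂ (J1 - J2)) (min R₂ (J1 - J2)) (twIU PU K (twQU P (WZ2 W)))
      (J1 - min R₂ (J1 - J2)) (by linarith) (by linarith) hb0 nU2 (by linarith) (by linarith)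
      (by
        rcases min_choice R₂ (J1 - J2) with h | h
        · rw [h]; linarith
        · rw [h]; linarith)
      le_rfl (by linarith) (Or.inr (by linarith)) ε hε
    refine ⟨n, hn, K₁, K₂, hK1, hK2, le_trans (key _ _ _ n.cast_nonneg ?_) l1,
      le_trans (key _ _ _ n.cast_nonneg ?_) l2, rest⟩
    · linarith
    · linarith

/-- for a discrete memoryless two-level security wiretap channel with
`X → Z₁ → Z₂`, any nonnegative pair with `R₁ ≤ I(V;Y|U) − I(V;Z₁|U)` and
`R₁ + R₂ ≤ I(V;Y) − I(V;Z₂)` for some `p(u,v,x)` with `U → V → X → (Y,Z₁,Z₂)` and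
`I(U;Y) ≥ I(U;Z₂)` is achievable. -/
theorem stmt1_superposition_inner_bound
    (W : 𝒳 → 𝒴 × 𝒵₁ × 𝒵₂ → ℝ) (hW : IsChannel W) (hdeg : DegradedZ1Z2 W)
    (R₁ R₂ : ℝ) (hR₁ : 0 ≤ R₁) (hR₂ : 0 ≤ R₂)
    {𝒰 𝒱 : Type} [Fintype 𝒰] [Fintype 𝒱]
    (pUVX : 𝒰 × 𝒱 × 𝒳 → ℝ) (hpUVX : IsPMF pUVX)
    -- Markov chain U → V → X (so that U → V → X → (Y,Z₁,Z₂) holds for the memoryless channel)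
    (hMarkov : ∀ u v x,
      pUVX (u, v, x) * (∑ u', ∑ x', pUVX (u', v, x')) =
        (∑ x', pUVX (u, v, x')) * (∑ u', pUVX (u', v, x)))
    -- I(U;Y) ≥ I(U;Z₂)
    (hUY : mutInfo (fun q : 𝒰 × 𝒴 => ∑ v, ∑ x, pUVX (q.1, v, x) * WY W x q.2) ≥
      mutInfo (fun q : 𝒰 × 𝒵₂ => ∑ v, ∑ x, pUVX (q.1, v, x) * WZ2 W x q.2))
    -- R₁ ≤ I(V;Y|U) − I(V;Z₁|U)
    (h₁ : R₁ ≤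
      condMutInfo (fun t : 𝒱 × 𝒴 × 𝒰 => ∑ x, pUVX (t.2.2, t.1, x) * WY W x t.2.1) -
        condMutInfo (fun t : 𝒱 × 𝒵₁ × 𝒰 => ∑ x, pUVX (t.2.2, t.1, x) * WZ1 W x t.2.1))
    -- R₁ + R₂ ≤ I(V;Y) − I(V;Z₂)
    (h₂ : R₁ + R₂ ≤
      mutInfo (fun q : 𝒱 × 𝒴 => ∑ u, ∑ x, pUVX (u, q.1, x) * WY W x q.2) -
        mutInfo (fun q : 𝒱 × 𝒵₂ => ∑ u, ∑ x, pUVX (u, q.1, x) * WZ2 W x q.2)) :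
    Achievable W R₁ R₂ := by
  obtain ⟨PU, K, P, hPU, hK, hP, hfac⟩ := tw_factor pUVX hpUVX hMarkov
  have hx : ∀ {Z : Type} (Wq : 𝒳 → Z → ℝ) (u : 𝒰) (v : 𝒱) (z : Z),
      ∑ x, pUVX (u, v, x) * Wq x z = PU u * K u v * twQU P Wq v z := by
    intro Z Wq u v z
    unfold twQU
    rw [Finset.mul_sum]
    refine Finset.sum_congr rfl fun x _ => ?_
    rw [hfac]; ring
  have hQY := tw_QU_chan hP (tw_WY_chan hW)
  have hQ1 := tw_QU_chan hP (tw_WZ1_chan hW)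
  have hQ2 := tw_QU_chan hP (tw_WZ2_chan hW)
  rw [tw_mi_U hK hQY _ (fun u z => Finset.sum_congr rfl fun v _ => hx (WY W) u v z),
    tw_mi_U hK hQ2 _ (fun u z => Finset.sum_congr rfl fun v _ => hx (WZ2 W) u v z)] at hUY
  rw [tw_mi_C hK hQY _ (fun v z u => hx (WY W) u v z),
    tw_mi_C hK hQ1 _ (fun v z u => hx (WZ1 W) u v z)] at h₁
  rw [tw_mi_V hQY _ (fun v z => Finset.sum_congr rfl fun u _ => hx (WY W) u v z),
    tw_mi_V hQ2 _ (fun v z => Finset.sum_congr rfl fun u _ => hx (WZ2 W) u v z)] at h₂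
  refine tw_achieve hW hPU hK hP R₁ R₂ hR₁ hR₂ ?_ hUY h₁ h₂
  obtain ⟨q, hq, hWq⟩ := hdeg
  have he : twQU P (WZ2 W) = twQU (twQU P (WZ1 W)) q := by
    funext v z
    unfold twQU
    simp only [Finset.sum_mul]
    rw [Finset.sum_comm]
    refine Finset.sum_congr rfl fun x _ => ?_
    simp only [mul_assoc, ← Finset.mul_sum]
    congr 1
    unfold WZ2 WZ1
    rw [Finset.sum_comm]
    exact Finset.sum_congr rfl fun z₁ _ => hWq x z₁ z
  rw [he]
  exact twIC_dpi hPU hK hQ1 hq
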